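/- Every 2-planar finite simple graph G on n ≥ 2 vertices can be drawn in the plane with at most (10·n − 20)/3 crossings; in particular, cr(G) ≤ (10·n − 20)/3. -/

import Mathlib

open unitInterval

/-- A (good) drawing of a simple graph in the plane: vertices map to distinct
points, each edge is drawn as a simple continuous arc between its endpoints,
arcs avoid vertex points other than their endpoints, two arcs meet in finitely
many points, and no three arcs pass through a common interior point. -/
structure PlaneDrawing {V : Type*} (G : SimpleGraph V) where
  pos : V → ℝ × ℝ
  pos_inj : Function.Injective pos
  arc : ∀ ⦃u v : V⦄, G.Adj u v → Path (pos u) (pos v)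
  arc_symm : ∀ ⦃u v : V⦄ (h : G.Adj u v), arc h.symm = (arc h).symm
  arc_inj : ∀ ⦃u v : V⦄ (h : G.Adj u v), Function.Injective (arc h)
  no_vertex_mem : ∀ ⦃u v : V⦄ (h : G.Adj u v) (w : V) (t : I),
      arc h t = pos w → w = u ∨ w = v
  finite_inter : ∀ ⦃u v x y : V⦄ (h₁ : G.Adj u v) (h₂ : G.Adj x y),
      s(u, v) ≠ s(x, y) →
      (Set.range (arc h₁) ∩ Set.range (arc h₂)).Finite
  no_triple_point : ∀ ⦃u₁ v₁ u₂ v₂ u₃ v₃ : V⦄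
      (h₁ : G.Adj u₁ v₁) (h₂ : G.Adj u₂ v₂) (h₃ : G.Adj u₃ v₃),
      s(u₁, v₁) ≠ s(u₂, v₂) → s(u₁, v₁) ≠ s(u₃, v₃) → s(u₂, v₂) ≠ s(u₃, v₃) →
      ∀ t₁ t₂ t₃ : I, t₁ ≠ 0 → t₁ ≠ 1 → t₂ ≠ 0 → t₂ ≠ 1 → t₃ ≠ 0 → t₃ ≠ 1 →
      arc h₁ t₁ = arc h₂ t₂ → arc h₂ t₂ = arc h₃ t₃ → False

namespace PlaneDrawing

variable {V : Type*} {G : SimpleGraph V} (D : PlaneDrawing G)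

/-- `p` is an interior point of the arc of the edge `uv`. -/
def IsInteriorPoint {u v : V} (h : G.Adj u v) (p : ℝ × ℝ) : Prop :=
  ∃ t : I, t ≠ 0 ∧ t ≠ 1 ∧ D.arc h t = p

/-- The set of crossing points of the drawing: points where the interiors of
the arcs of two distinct edges meet. -/
def crossings : Set (ℝ × ℝ) :=
  {p | ∃ (u v x y : V) (h₁ : G.Adj u v) (h₂ : G.Adj x y),
    s(u, v) ≠ s(x, y) ∧ D.IsInteriorPoint h₁ p ∧ D.IsInteriorPoint h₂ p}

/-- The number of crossings of the drawing. -/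
noncomputable def crossingCount : ℕ := D.crossings.ncard

/-- The set of crossing points lying on the edge `uv`. -/
def edgeCrossings {u v : V} (h : G.Adj u v) : Set (ℝ × ℝ) :=
  {p | D.IsInteriorPoint h p ∧
    ∃ (x y : V) (h₂ : G.Adj x y), s(u, v) ≠ s(x, y) ∧ D.IsInteriorPoint h₂ p}

/-- A drawing is `k`-plane if every edge is involved in at most `k` crossings. -/
def IsKPlane (k : ℕ) : Prop :=
  ∀ ⦃u v : V⦄ (h : G.Adj u v), (D.edgeCrossings h).ncard ≤ k

end PlaneDrawing

/-- The crossing number of a graph: the minimum number of crossings over all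
drawings. -/
noncomputable def crossingNumber {V : Type*} (G : SimpleGraph V) : ℕ :=
  sInf {c : ℕ | ∃ D : PlaneDrawing G, D.crossingCount = c}

/-- A graph is `k`-planar if it admits a drawing in which every edge is
involved in at most `k` crossings. -/
def KPlanar {V : Type*} (G : SimpleGraph V) (k : ℕ) : Prop :=
  ∃ D : PlaneDrawing G, D.IsKPlane k

/-- `G` has no cycle of length `ℓ`. -/
def HasNoCycleOfLength {V : Type*} (G : SimpleGraph V) (ℓ : ℕ) : Prop :=
  ∀ (v : V) (c : G.Walk v v), c.IsCycle → c.length ≠ ℓ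

namespace WindingParity

instance contractibleSpace_unitInterval : ContractibleSpace I :=
  (convex_Icc 0 1).contractibleSpace ⟨0, by simp⟩

instance locallyPathConnectedSpace_unitInterval : LocallyPathConnectedSpace I :=
  (isQuotientMap_projIcc (h := zero_le_one' ℝ)).locallyPathConnectedSpace

theorem exists_log_lift {A : Type*} [TopologicalSpace A] [SimplyConnectedSpace A]
    [LocallyPathConnectedSpace A] (f : C(A, ℂ)) (hf : ∀ a, f a ≠ 0) :
    ∃ F : C(A, ℂ), ∀ a, Complex.exp (F a) = f a := by
  obtain ⟨a₀⟩ : Nonempty A := inferInstance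
  obtain ⟨F, ⟨-, hF⟩, -⟩ := Complex.isCoveringMapOn_exp.existsUnique_continuousMap_lifts f
    (a₀ := a₀) (e₀ := Complex.log (f a₀)) (Complex.exp_log (hf a₀)) (fun a => by simpa using hf a)
  exact ⟨F, fun a => congrFun hF a⟩

theorem log_lift_sub {A : Type*} [TopologicalSpace A] [SimplyConnectedSpace A]
    [LocallyPathConnectedSpace A] (F F' : C(A, ℂ))
    (h : ∀ a, Complex.exp (F a) = Complex.exp (F' a)) (a b : A) :
    F a - F b = F' a - F' b := by
  let f : C(A, ℂ) := ⟨fun a => Complex.exp (F a), by fun_prop⟩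
  have hu := Complex.isCoveringMapOn_exp.existsUnique_continuousMap_lifts f
    (a₀ := b) (e₀ := F b) rfl (fun a => by simp [f])
  let F'' : C(A, ℂ) := ⟨fun a => F' a + (F b - F' b), by fun_prop⟩
  have h1 : F = F'' := by
    refine hu.unique ⟨rfl, rfl⟩ ⟨by simp [F''], ?_⟩
    funext a
    simp [F'', f, Complex.exp_add, Complex.exp_sub, h]
  have h2 : F a = F' a + (F b - F' b) := by
    conv_lhs => rw [h1]
    rfl
  rw [h2]; ring

/-- The variation of a continuous logarithm of `γ - z` along `γ`. -/
noncomputable def logVariation {a b : ℂ} (γ : Path a b) (z : ℂ) : ℂ :=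
  open Classical in
  if h : ∃ F : C(I, ℂ), ∀ t, Complex.exp (F t) = γ t - z then h.choose 1 - h.choose 0 else 0

theorem logVariation_eq {a b : ℂ} (γ : Path a b) (z : ℂ) (F : C(I, ℂ))
    (hF : ∀ t, Complex.exp (F t) = γ t - z) : logVariation γ z = F 1 - F 0 := by
  have h : ∃ F : C(I, ℂ), ∀ t, Complex.exp (F t) = γ t - z := ⟨F, hF⟩
  rw [logVariation, dif_pos h]
  exact log_lift_sub _ _ (fun t => by rw [h.choose_spec, hF]) _ _

theorem exists_logVariation_eq {a b : ℂ} (γ : Path a b) (z : ℂ) (hz : ∀ t, γ t ≠ z) :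
    ∃ n : ℤ, logVariation γ z =
      Complex.log (b - z) - Complex.log (a - z) + n * (2 * Real.pi * Complex.I) := by
  obtain ⟨F, hF⟩ := exists_log_lift (⟨fun t => γ t - z, by fun_prop⟩ : C(I, ℂ))
    (fun t => sub_ne_zero.2 (hz t))
  have hb : b - z ≠ 0 := sub_ne_zero.2 (by simpa using hz 1)
  have ha : a - z ≠ 0 := sub_ne_zero.2 (by simpa using hz 0)
  have : Complex.exp (F 1 - F 0) = Complex.exp (Complex.log (b - z) - Complex.log (a - z)) := by
    rw [Complex.exp_sub, Complex.exp_sub, Complex.exp_log hb, Complex.exp_log ha, hF, hF]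
    simp
  obtain ⟨n, hn⟩ := Complex.exp_eq_exp_iff_exists_int.1 this
  exact ⟨n, by rw [logVariation_eq γ z F hF, hn]⟩

theorem logVariation_reciprocity {a b c d : ℂ} (γ : Path a b) (δ : Path c d)
    (h : ∀ s t, γ s ≠ δ t) :
    logVariation γ d - logVariation γ c = logVariation δ b - logVariation δ a := by
  obtain ⟨G, hG⟩ := exists_log_lift
    (⟨fun p => γ p.1 - δ p.2, by fun_prop⟩ : C(I × I, ℂ)) (fun p => sub_ne_zero.2 (h _ _))
  simp only [ContinuousMap.coe_mk] at hG
  have hneg (s t : I) : Complex.exp (G (s, t) + Real.pi * Complex.I) = δ t - γ s := by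
    rw [Complex.exp_add, hG, Complex.exp_pi_mul_I]; ring
  rw [logVariation_eq γ d ⟨fun s => G (s, 1), by fun_prop⟩ (fun s => by simp [hG]),
    logVariation_eq γ c ⟨fun s => G (s, 0), by fun_prop⟩ (fun s => by simp [hG]),
    logVariation_eq δ b ⟨fun t => G (1, t) + Real.pi * Complex.I, by fun_prop⟩
      (fun s => by simp [hneg]),
    logVariation_eq δ a ⟨fun t => G (0, t) + Real.pi * Complex.I, by fun_prop⟩
      (fun s => by simp [hneg])]
  simp only [ContinuousMap.coe_mk]
  ring

theorem exists_log_sub_sub_log_sub {w z : ℂ} (h : w ≠ z) :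
    ∃ n : ℤ, Complex.log (w - z) - Complex.log (z - w) =
      (2 * n + 1) * (Real.pi * Complex.I) := by
  have h1 : w - z ≠ 0 := sub_ne_zero.2 h
  have h2 : z - w ≠ 0 := sub_ne_zero.2 h.symm
  have : Complex.exp (Complex.log (w - z) - Complex.log (z - w))
      = Complex.exp (Real.pi * Complex.I) := by
    rw [Complex.exp_sub, Complex.exp_log h1, Complex.exp_log h2, Complex.exp_pi_mul_I,
      div_eq_iff h2]
    ring
  obtain ⟨n, hn⟩ := Complex.exp_eq_exp_iff_exists_int.1 this
  exact ⟨n, by rw [hn]; ring⟩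

/-- There is no drawing of `K_{3,3}` in the plane in which independent edges are disjoint. -/
theorem not_exists_K33_paths (a b : Fin 3 → ℂ) (γ : ∀ i j, Path (a i) (b j))
    (h : ∀ i j k l, i ≠ k → j ≠ l → ∀ s t, γ i j s ≠ γ k l t) : False := by
  have haa (i k : Fin 3) (hik : i ≠ k) : a i ≠ a k := by
    simpa using h i 0 k 1 hik (by decide) 0 0
  have hbb (i k : Fin 3) (hik : i ≠ k) : b i ≠ b k := by
    simpa using h 0 i 1 k (by decide) hik 1 1
  have hab (i j : Fin 3) : a i ≠ b j := by
    simpa using h i (j + 1) (i + 1) j (by revert i; decide) (by revert j; decide) 0 1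
  have key : ∀ w z : ℂ, ∃ n : ℤ, w ≠ z → Complex.log (w - z) - Complex.log (z - w) =
      (2 * n + 1) * (Real.pi * Complex.I) := fun w z => by
    by_cases hwz : w = z
    · exact ⟨0, fun h => absurd hwz h⟩
    · obtain ⟨n, hn⟩ := exists_log_sub_sub_log_sub hwz
      exact ⟨n, fun _ => hn⟩
  choose e he using key
  have key2 : ∀ (i j : Fin 3) (z : ℂ), ∃ n : ℤ, (∀ t, γ i j t ≠ z) → logVariation (γ i j) z =
      Complex.log (b j - z) - Complex.log (a i - z) + n * (2 * Real.pi * Complex.I) :=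
    fun i j z => by
    by_cases hz : ∀ t, γ i j t ≠ z
    · obtain ⟨n, hn⟩ := exists_logVariation_eq (γ i j) z hz
      exact ⟨n, fun _ => hn⟩
    · exact ⟨0, fun h => absurd h hz⟩
  choose n hn using key2
  have hpi : (Real.pi * Complex.I : ℂ) ≠ 0 :=
    mul_ne_zero (by exact_mod_cast Real.pi_ne_zero) Complex.I_ne_zero
  have rel (i k j l : Fin 3) (hik : i ≠ k) (hjl : j ≠ l) :
      (2 * e (b j) (b l) + 1) + (2 * e (b l) (a i) + 1) + (2 * e (a k) (b j) + 1)
        + (2 * e (a i) (a k) + 1)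
        + 2 * (n i j (b l) - n i j (a k) - n k l (b j) + n k l (a i)) = 0 := by
    have h1 := logVariation_reciprocity (γ i j) (γ k l) (h i j k l hik hjl)
    rw [hn i j _ (fun t => by simpa using h i j k l hik hjl t 1),
      hn i j _ (fun t => by simpa using h i j k l hik hjl t 0),
      hn k l _ (fun t => by simpa using (h i j k l hik hjl 1 t).symm),
      hn k l _ (fun t => by simpa using (h i j k l hik hjl 0 t).symm)] at h1
    have e1 := he (b j) (b l) (hbb j l hjl)
    have e2 := he (b l) (a i) (hab i l).symm
    have e3 := he (a k) (b j) (hab k j)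
    have e4 := he (a i) (a k) (haa i k hik)
    have : (((2 * e (b j) (b l) + 1) + (2 * e (b l) (a i) + 1) + (2 * e (a k) (b j) + 1)
        + (2 * e (a i) (a k) + 1)
        + 2 * (n i j (b l) - n i j (a k) - n k l (b j) + n k l (a i)) : ℤ) : ℂ)
        * (Real.pi * Complex.I) = 0 := by
      push_cast
      linear_combination h1 - e1 - e2 - e3 - e4
    exact_mod_cast (mul_eq_zero.1 this).resolve_right hpi
  have anti (w z : ℂ) (hwz : w ≠ z) : e w z + e z w + 1 = 0 := by
    have h1 := he w z hwz
    have h2 := he z w hwz.symm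
    have : ((e w z + e z w + 1 : ℤ) : ℂ) * (2 * (Real.pi * Complex.I)) = 0 := by
      push_cast
      linear_combination - h1 - h2
    exact_mod_cast (mul_eq_zero.1 this).resolve_right (mul_ne_zero two_ne_zero hpi)
  have s1 (i k : Fin 3) (hik : i ≠ k) := rel i k 0 1 hik (by decide)
  have s2 (i k : Fin 3) (hik : i ≠ k) := rel i k 1 0 hik (by decide)
  have s3 (i k : Fin 3) (hik : i ≠ k) := rel i k 0 2 hik (by decide)
  have s4 (i k : Fin 3) (hik : i ≠ k) := rel i k 2 0 hik (by decide)
  have s5 (i k : Fin 3) (hik : i ≠ k) := rel i k 1 2 hik (by decide)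
  have s6 (i k : Fin 3) (hik : i ≠ k) := rel i k 2 1 hik (by decide)
  have t1 := anti _ _ (hbb 0 1 (by decide))
  have t2 := anti _ _ (hbb 0 2 (by decide))
  have t3 := anti _ _ (hbb 1 2 (by decide))
  have S (i k : Fin 3) (hik : i ≠ k) := by
    have := s1 i k hik
    have := s2 i k hik
    have := s3 i k hik
    have := s4 i k hik
    have := s5 i k hik
    have := s6 i k hik
    exact (by linarith : (2 * e (b 0) (a i) + 2 * e (b 1) (a i) + 2 * e (b 2) (a i) +
      2 * e (a k) (b 0) + 2 * e (a k) (b 1) + 2 * e (a k) (b 2) + 6 * e (a i) (a k) + 9) +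
      (n i 0 (b 1) - n i 0 (a k) - n k 1 (b 0) + n k 1 (a i)) +
      (n i 1 (b 0) - n i 1 (a k) - n k 0 (b 1) + n k 0 (a i)) +
      (n i 0 (b 2) - n i 0 (a k) - n k 2 (b 0) + n k 2 (a i)) +
      (n i 2 (b 0) - n i 2 (a k) - n k 0 (b 2) + n k 0 (a i)) +
      (n i 1 (b 2) - n i 1 (a k) - n k 2 (b 1) + n k 2 (a i)) +
      (n i 2 (b 1) - n i 2 (a k) - n k 1 (b 2) + n k 1 (a i)) = 0)
  have S1 := S 0 1 (by decide)
  have S2 := S 0 2 (by decide)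
  have S3 := S 1 2 (by decide)
  omega

/-- There is no `K_{3,3}` of plane sets in which independent edges are disjoint. -/
theorem not_exists_K33_sets (a b : Fin 3 → ℂ) (K : Fin 3 → Fin 3 → Set ℂ)
    (hK : ∀ i j, JoinedIn (K i j) (a i) (b j))
    (h : ∀ i j k l, i ≠ k → j ≠ l → Disjoint (K i j) (K k l)) : False :=
  not_exists_K33_paths a b (fun i j => (hK i j).somePath) fun i j k l hik hjl s t hst =>
    Set.disjoint_left.1 (h i j k l hik hjl) ((hK i j).somePath_mem s)
      (hst ▸ (hK k l).somePath_mem t)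

end WindingParity

/-- A set `E` of edges can be represented by path-connected plane sets such that
disjoint edges are represented by disjoint sets. -/
def HasWeakDrawing {W : Type*} (E : Finset (Sym2 W)) : Prop :=
  ∃ (K : Sym2 W → Set ℂ) (r : W → ℂ),
    (∀ e ∈ E, IsPathConnected (K e) ∧ ∀ x ∈ e, r x ∈ K e) ∧
    ∀ e ∈ E, ∀ f ∈ E, (∀ x ∈ e, x ∉ f) → Disjoint (K e) (K f)

/-- `E` is a set of edges on the vertex set `S`, properly coloured by `col`. -/
def IsBipartiteOn {W : Type*} (col : W → Bool) (S : Finset W) (E : Finset (Sym2 W)) : Prop :=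
  ∀ x y, s(x, y) ∈ E → col x ≠ col y ∧ x ∈ S ∧ y ∈ S

namespace HasWeakDrawing

variable {W : Type*}

theorem mono {E F : Finset (Sym2 W)} (h : HasWeakDrawing F) (hEF : E ⊆ F) : HasWeakDrawing E := by
  obtain ⟨K, r, h1, h2⟩ := h
  exact ⟨K, r, fun e he => h1 e (hEF he), fun e he f hf => h2 e (hEF he) f (hEF hf)⟩

/-- Contracting the path `a - v - b`. -/
theorem contract [DecidableEq W] {E : Finset (Sym2 W)} (h : HasWeakDrawing E)
    {a b v : W} (hva : s(v, a) ∈ E) (hvb : s(v, b) ∈ E)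
    {E₁ : Finset (Sym2 W)} (hE₁ : E₁ ⊆ E) (hv : ∀ e ∈ E₁, v ∉ e) :
    HasWeakDrawing (E₁.image (Sym2.map (Function.update id b a))) := by
  classical
  obtain ⟨K, r, h1, h2⟩ := h
  set φ : W → W := Function.update id b a with hφ
  have hφa : φ a = a := by
    by_cases hab : a = b
    · simp [hφ, hab]
    · simp [hφ, Function.update_of_ne hab]
  have hφb : φ b = a := by simp [hφ]
  have hφx (x : W) (hx : φ x = a) : x = a ∨ x = b := by
    by_cases hxb : x = b
    · exact Or.inr hxb
    · left; simpa [hφ, Function.update_of_ne hxb] using hx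
  have hφne (x : W) (hx : φ x ≠ a) : φ x = x := by
    by_cases hxb : x = b
    · exact absurd (hxb ▸ hφb) hx
    · simp [hφ, Function.update_of_ne hxb]
  have key : ∀ e' : Sym2 W, ∃ e : Sym2 W, e' ∈ E₁.image (Sym2.map φ) →
      e ∈ E₁ ∧ Sym2.map φ e = e' := fun e' => by
    by_cases he' : e' ∈ E₁.image (Sym2.map φ)
    · obtain ⟨e, he⟩ := Finset.mem_image.1 he'
      exact ⟨e, fun _ => he⟩
    · exact ⟨e', fun h => absurd h he'⟩
  choose pre hpre using key
  refine ⟨fun e' => if a ∈ e' then K s(v, a) ∪ K s(v, b) ∪ K (pre e') else K (pre e'), r, ?_, ?_⟩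
  · intro e' he'
    obtain ⟨hp1, hp2⟩ := hpre e' he'
    obtain ⟨hc, hr⟩ := h1 _ (hE₁ hp1)
    by_cases hae : a ∈ e'
    · simp only [hae, if_true]
      have hcv : IsPathConnected (K s(v, a) ∪ K s(v, b)) :=
        (h1 _ hva).1.union (h1 _ hvb).1
          ⟨r v, (h1 _ hva).2 v (by simp), (h1 _ hvb).2 v (by simp)⟩
      constructor
      · refine hcv.union hc ?_
        rw [← hp2, Sym2.mem_map] at hae
        obtain ⟨x, hx, hxa⟩ := hae
        rcases hφx x hxa with rfl | rfl
        · exact ⟨r x, Or.inl ((h1 _ hva).2 x (by simp)), hr x hx⟩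
        · exact ⟨r x, Or.inr ((h1 _ hvb).2 x (by simp)), hr x hx⟩
      · intro x hx
        by_cases hxa : x = a
        · exact Or.inl (Or.inl ((h1 _ hva).2 x (by simp [hxa])))
        · rw [← hp2, Sym2.mem_map] at hx
          obtain ⟨y, hy, rfl⟩ := hx
          rw [hφne y hxa]
          exact Or.inr (hr y hy)
    · simp only [hae, if_false]
      refine ⟨hc, fun x hx => ?_⟩
      have hxa : x ≠ a := fun h => hae (h ▸ hx)
      rw [← hp2, Sym2.mem_map] at hx
      obtain ⟨y, hy, rfl⟩ := hx
      rw [hφne y hxa]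
      exact hr y hy
  · have side : ∀ e' ∈ E₁.image (Sym2.map φ), ∀ f' ∈ E₁.image (Sym2.map φ),
        (∀ x ∈ e', x ∉ f') → a ∉ f' →
        Disjoint (K s(v, a) ∪ K s(v, b) ∪ K (pre e')) (K (pre f')) := by
      intro e' he' f' hf' hef haf
      obtain ⟨hp1, hp2⟩ := hpre e' he'
      obtain ⟨hq1, hq2⟩ := hpre f' hf'
      have hqa (x : W) (hx : φ x = a) : x ∉ pre f' := fun hxf => haf (by
        rw [← hq2, Sym2.mem_map]; exact ⟨x, hxf, hx⟩)
      refine (Disjoint.sup_left (Disjoint.sup_left (h2 _ hva _ (hE₁ hq1) ?_)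
        (h2 _ hvb _ (hE₁ hq1) ?_)) (h2 _ (hE₁ hp1) _ (hE₁ hq1) ?_))
      · intro x hx
        rcases Sym2.mem_iff.1 hx with rfl | rfl
        · exact hv _ hq1
        · exact hqa _ hφa
      · intro x hx
        rcases Sym2.mem_iff.1 hx with rfl | rfl
        · exact hv _ hq1
        · exact hqa _ hφb
      · intro x hx hx'
        refine hef (φ x) ?_ ?_
        · rw [← hp2, Sym2.mem_map]; exact ⟨x, hx, rfl⟩
        · rw [← hq2, Sym2.mem_map]; exact ⟨x, hx', rfl⟩
    intro e' he' f' hf' hef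
    by_cases hae : a ∈ e'
    · simp only [hae, hef a hae, if_true, if_false]
      exact side e' he' f' hf' hef (hef a hae)
    · by_cases haf : a ∈ f'
      · simp only [hae, haf, if_true, if_false]
        exact (side f' hf' e' he' (fun x hx hx' => hef x hx' hx) hae).symm
      · simp only [hae, haf, if_false]
        exact (side e' he' f' hf' hef haf).mono_left Set.subset_union_right

end HasWeakDrawing

namespace IsBipartiteOn

variable {W : Type*} {col : W → Bool} {S : Finset W} {E : Finset (Sym2 W)}

theorem mono (h : IsBipartiteOn col S E) {F : Finset (Sym2 W)} (hFE : F ⊆ E) :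
    IsBipartiteOn col S F := fun x y hxy => h x y (hFE hxy)

theorem restrict (h : IsBipartiteOn col S E) {F : Finset (Sym2 W)} (hFE : F ⊆ E) {T : Finset W}
    (hT : ∀ e ∈ F, ∀ x ∈ e, x ∈ S → x ∈ T) : IsBipartiteOn col T F := fun x y hxy => by
  obtain ⟨h1, h2, h3⟩ := h x y (hFE hxy)
  exact ⟨h1, hT _ hxy x (by simp) h2, hT _ hxy y (by simp) h3⟩

theorem sum_degree [DecidableEq W] (h : IsBipartiteOn col S E) :
    ∑ v ∈ S, (E.filter (v ∈ ·)).card = 2 * E.card := by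
  have := Finset.sum_card_bipartiteAbove_eq_sum_card_bipartiteBelow (s := S) (t := E)
    (fun (v : W) (e : Sym2 W) => v ∈ e)
  simp only [Finset.bipartiteAbove, Finset.bipartiteBelow] at this
  rw [this, Finset.sum_const_nat (m := 2), mul_comm]
  intro e he
  induction e using Sym2.ind with
  | _ x y =>
    obtain ⟨h1, h2, h3⟩ := h x y he
    have hxy : x ≠ y := fun h => h1 (h ▸ rfl)
    rw [← Finset.card_pair hxy]
    congr 1
    ext z
    simp only [Finset.mem_filter, Sym2.mem_iff, Finset.mem_insert, Finset.mem_singleton]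
    constructor
    · exact fun h => h.2
    · rintro (rfl | rfl) <;> simp [*]

theorem card_le_two_of_card_eq_three [DecidableEq W] (h : IsBipartiteOn col S E)
    (hS : S.card = 3) : E.card ≤ 2 := by
  obtain ⟨x, y, z, -, -, -, rfl⟩ := Finset.card_eq_three.1 hS
  have key : ∀ x y z : W, (∀ p q, s(p, q) ∈ E → col p ≠ col q ∧ (p = x ∨ p = y ∨ p = z) ∧
      (q = x ∨ q = y ∨ q = z)) → col x = col y → E.card ≤ 2 := by
    intro x y z h hc
    refine (Finset.card_le_card (t := {s(x, z), s(y, z)}) ?_).trans Finset.card_le_two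
    intro e he
    induction e using Sym2.ind with
    | _ p q =>
      obtain ⟨h1, h2, h3⟩ := h p q he
      rcases h2 with rfl | rfl | rfl <;> rcases h3 with rfl | rfl | rfl <;> simp_all [Sym2.eq_swap]
  have h' (p q : W) (hpq : s(p, q) ∈ E) := h p q hpq
  simp only [Finset.mem_insert, Finset.mem_singleton] at h'
  rcases Bool.eq_or_eq_not (col x) (col y) with h1 | h1
  · exact key x y z h' h1
  · rcases Bool.eq_or_eq_not (col x) (col z) with h2 | h2
    · exact key x z y (fun p q hpq => by have := h' p q hpq; tauto) h2
    · exact key y z x (fun p q hpq => by have := h' p q hpq; tauto) (by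
        rw [h1] at h2; simpa using h2)

theorem ne (h : IsBipartiteOn col S E) {x y : W} (hxy : s(x, y) ∈ E) : x ≠ y :=
  fun e => (h x y hxy).1 (e ▸ rfl)

/-- Two vertices `a`, `b` and a connected set `Y₀` of vertices cannot all be adjacent
to three further vertices of the colour opposite to that of `a` and `b`. -/
theorem not_K33 [DecidableEq W] (h : IsBipartiteOn col S E) (hw : HasWeakDrawing E)
    {a b c : W} {v : Fin 3 → W} {y : Fin 3 → W} {Y : Set W}
    (hab : a ≠ b) (hv : Function.Injective v)
    (hav : ∀ i, s(a, v i) ∈ E) (hbv : ∀ i, s(b, v i) ∈ E)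
    (haY : a ∉ Y) (hbY : b ∉ Y) (hvY : ∀ i, v i ∉ Y) (hcY : c ∈ Y)
    (hc : ∀ t, ∃ z ≠ t, s(c, z) ∈ E) (hca : col c = col a)
    (hyv : ∀ i, s(y i, v i) ∈ E)
    (hy : ∀ i, Relation.ReflTransGen (fun x z => s(x, z) ∈ E ∧ x ∈ Y ∧ z ∈ Y) c (y i)) :
    False := by
  obtain ⟨K, r, h1, h2⟩ := hw
  have hcol (i : Fin 3) : col a ≠ col (v i) := (h _ _ (hav i)).1
  have hcolb (i : Fin 3) : col b ≠ col (v i) := (h _ _ (hbv i)).1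
  have hyY (i : Fin 3) : y i ∈ Y := by
    rcases (hy i).cases_tail with h | ⟨_, _, h⟩
    · rwa [h]
    · exact h.2.2
  set U : Set ℂ := {r c} ∪ ⋃ e ∈ {e | e ∈ E ∧ ∀ x ∈ e, x ∈ Y}, K e with hU
  have hjoin (z : W) (hz : Relation.ReflTransGen (fun x z => s(x, z) ∈ E ∧ x ∈ Y ∧ z ∈ Y) c z) :
      JoinedIn U (r c) (r z) := by
    induction hz with
    | refl => exact JoinedIn.refl (Or.inl rfl)
    | @tail p q _ hpq ih =>
      refine ih.trans (((h1 _ hpq.1).1.joinedIn _ ((h1 _ hpq.1).2 p (by simp)) _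
        ((h1 _ hpq.1).2 q (by simp))).mono ?_)
      refine Set.subset_union_of_subset_right (Set.subset_biUnion_of_mem (u := fun e => K e) ?_) _
      refine ⟨hpq.1, fun x hx => ?_⟩
      rcases Sym2.mem_iff.1 hx with rfl | rfl
      exacts [hpq.2.1, hpq.2.2]
  have hdisj (x t : W) (i : Fin 3) (hxt : s(x, t) ∈ E) (hx : x ∉ Y) (ht : t ∉ Y) (hti : v i ≠ t)
      (hxi : x ≠ v i) (hcx : col c = col x) : Disjoint (U ∪ K s(y i, v i)) (K s(x, t)) := by
    have hmem (z : W) (hz : z ∈ s(x, t)) : z ∉ Y ∧ z ≠ v i := by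
      rcases Sym2.mem_iff.1 hz with rfl | rfl
      exacts [⟨hx, hxi⟩, ⟨ht, hti.symm⟩]
    refine Disjoint.sup_left (Disjoint.sup_left ?_ ?_) (h2 _ (hyv i) _ hxt ?_)
    · rw [Set.disjoint_singleton_left]
      obtain ⟨z, hzt, hz⟩ := hc t
      refine Set.disjoint_left.1 (h2 _ hz _ hxt ?_) ((h1 _ hz).2 c (by simp))
      intro w hw hw'
      have := hmem w hw'
      rcases Sym2.mem_iff.1 hw with rfl | rfl
      · exact this.1 hcY
      · rcases Sym2.mem_iff.1 hw' with rfl | rfl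
        · exact (h _ _ hz).1 hcx
        · exact hzt rfl
    · refine Set.disjoint_iUnion₂_left.2 fun e he => h2 _ he.1 _ hxt fun w hw hw' => ?_
      exact (hmem w hw').1 (he.2 w hw)
    · intro w hw hw'
      have := hmem w hw'
      rcases Sym2.mem_iff.1 hw with rfl | rfl
      exacts [this.1 (hyY i), this.2 rfl]
  have hcb : col c = col b := by
    have h1 := hcol 0
    have h2 := hcolb 0
    revert h1 h2
    rw [hca]
    cases col a <;> cases col b <;> cases col (v 0) <;> simp
  have hedge (x : W) (i : Fin 3) (hx : s(x, v i) ∈ E) : JoinedIn (K s(x, v i)) (r x) (r (v i)) :=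
    (h1 _ hx).1.joinedIn _ ((h1 _ hx).2 x (by simp)) _ ((h1 _ hx).2 _ (by simp))
  have hij (x : W) (hx : ∀ i, s(x, v i) ∈ E) (i j : Fin 3) : x ≠ v i := h.ne (hx i)
  refine WindingParity.not_exists_K33_sets ![r a, r b, r c] (fun i => r (v i))
    ![fun i => K s(a, v i), fun i => K s(b, v i), fun i => U ∪ K s(y i, v i)] ?_ ?_
  · intro i j
    fin_cases i
    · exact hedge a j (hav j)
    · exact hedge b j (hbv j)
    · exact ((hjoin _ (hy j)).mono Set.subset_union_left).trans
        ((hedge _ j (hyv j)).mono Set.subset_union_right)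
  · have h01 (j l : Fin 3) (hjl : j ≠ l) : Disjoint (K s(a, v j)) (K s(b, v l)) := by
      refine h2 _ (hav j) _ (hbv l) fun w hw hw' => ?_
      rcases Sym2.mem_iff.1 hw with rfl | rfl <;> rcases Sym2.mem_iff.1 hw' with h3 | h3
      · exact hab h3
      · exact h.ne (hav l) h3
      · exact h.ne (hbv j) h3.symm
      · exact hjl (hv h3)
    have h20 (j l : Fin 3) (hjl : j ≠ l) := hdisj a (v l) j (hav l) haY (hvY l)
      (fun e => hjl (hv e)) (h.ne (hav j)) hca
    have h21 (j l : Fin 3) (hjl : j ≠ l) := hdisj b (v l) j (hbv l) hbY (hvY l)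
      (fun e => hjl (hv e)) (h.ne (hbv j)) hcb
    intro i j k l hik hjl
    fin_cases i <;> fin_cases k
    · exact absurd rfl hik
    · exact h01 j l hjl
    · exact (h20 l j hjl.symm).symm
    · exact (h01 l j hjl.symm).symm
    · exact absurd rfl hik
    · exact (h21 l j hjl.symm).symm
    · exact h20 j l hjl
    · exact h21 j l hjl
    · exact absurd rfl hik

/-- Splitting along a vertex set `C` spanning at least four edges. -/
theorem card_add_four_le_of_separation [DecidableEq W] (h : IsBipartiteOn col S E)
    (ih : ∀ T : Finset W, T.card < S.card → 3 ≤ T.card → ∀ F ⊆ E, IsBipartiteOn col T F →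
      F.card + 4 ≤ 2 * T.card)
    (C Y : Finset W) (hCS : C ⊆ S) (hYS : Y ⊆ S) (hC : C.card = 4) (hYC : Disjoint Y C)
    (hY : Y.Nonempty)
    (hsep : ∀ x y, s(x, y) ∈ E → x ∈ Y → y ∈ Y ∨ y ∈ C) (hout : ∃ p ∈ S, p ∉ Y ∧ p ∉ C)
    (Q : Finset (Sym2 W)) (hQ : Q.card = 4) (hQE : Q ⊆ E) (hQC : ∀ e ∈ Q, ∀ x ∈ e, x ∈ C) :
    E.card + 4 ≤ 2 * S.card := by
  classical
  set E₁ := E.filter (fun e => ∀ x ∈ e, x ∈ Y ∪ C) with hE₁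
  set E₂ := E.filter (fun e => ∀ x ∈ e, x ∉ Y) with hE₂
  have hunion : E ⊆ E₁ ∪ E₂ := by
    intro e he
    induction e using Sym2.ind with
    | _ x y =>
      have h1 := hsep x y he
      have h2 := hsep y x (Sym2.eq_swap ▸ he)
      simp only [hE₁, hE₂, Finset.mem_union, Finset.mem_filter, Sym2.ball, he, true_and]
      tauto
  have hinter : Q ⊆ E₁ ∩ E₂ := by
    intro e he
    simp only [hE₁, hE₂, Finset.mem_inter, Finset.mem_filter, Finset.mem_union]
    exact ⟨⟨hQE he, fun x hx => Or.inr (hQC e he x hx)⟩, hQE he, fun x hx hxY =>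
      Finset.disjoint_left.1 hYC hxY (hQC e he x hx)⟩
  have hcard := Finset.card_union_add_card_inter E₁ E₂
  have h1 := Finset.card_le_card hunion
  have h2 := Finset.card_le_card hinter
  have hYCc : (Y ∪ C).card = Y.card + 4 := by rw [Finset.card_union_of_disjoint hYC, hC]
  have hSY : (S \ Y).card + Y.card = S.card := Finset.card_sdiff_add_card_eq_card hYS
  have hYpos := hY.card_pos
  have hlt : (Y ∪ C).card < S.card := by
    obtain ⟨p, hpS, hpY, hpC⟩ := hout
    exact Finset.card_lt_card ⟨Finset.union_subset hYS hCS, fun hh => by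
      have := hh hpS
      simp [hpY, hpC] at this⟩
  have i1 := ih (Y ∪ C) hlt (by omega) E₁ (Finset.filter_subset _ _)
    (h.restrict (Finset.filter_subset _ _) fun e he x hx _ => (Finset.mem_filter.1 he).2 x hx)
  have i2 := ih (S \ Y) (by omega) (by omega) E₂ (Finset.filter_subset _ _)
    (h.restrict (Finset.filter_subset _ _) fun e he x hx hxS => by
      simp [hxS, (Finset.mem_filter.1 he).2 x hx])
  omega

theorem exists_neighbor_ne [DecidableEq W] {c : W} (hc : 2 ≤ (E.filter (c ∈ ·)).card) (t : W) :
    ∃ z ≠ t, s(c, z) ∈ E := by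
  obtain ⟨e, he, het⟩ := Finset.exists_mem_ne (s := E.filter (c ∈ ·)) (by omega) s(c, t)
  obtain ⟨heE, hce⟩ := Finset.mem_filter.1 he
  obtain ⟨z, rfl⟩ := Sym2.mem_iff_exists.1 hce
  exact ⟨z, fun h => het (h ▸ rfl), heE⟩

theorem card_image_contract [DecidableEq W] (h : IsBipartiteOn col S E) {a b : W}
    (hcol : col a = col b) (hne : a ≠ b) (hab : ∀ w, s(w, a) ∈ E → s(w, b) ∉ E) :
    (E.image (Sym2.map (Function.update id b a))).card = E.card := by
  set φ : W → W := Function.update id b a with hφ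
  have hφb : φ b = a := by simp [hφ]
  have hφne (x : W) (hx : x ≠ b) : φ x = x := by simp [hφ, Function.update_of_ne hx]
  have hcolφ (x : W) : col (φ x) = col x := by
    by_cases hx : x = b
    · rw [hx, hφb, hcol]
    · rw [hφne x hx]
  have hφeq (x y : W) (hxy : φ x = φ y) : x = y ∨ (x = a ∧ y = b) ∨ (x = b ∧ y = a) := by
    by_cases hx : x = b <;> by_cases hy : y = b
    · exact Or.inl (hx.trans hy.symm)
    · rw [hx, hφb, hφne y hy] at hxy; exact Or.inr (Or.inr ⟨hx, hxy.symm⟩)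
    · rw [hy, hφb, hφne x hx] at hxy; exact Or.inr (Or.inl ⟨hxy, hy⟩)
    · rw [hφne x hx, hφne y hy] at hxy; exact Or.inl hxy
  have main (x y z w : W) (hxy : s(x, y) ∈ E) (hzw : s(z, w) ∈ E) (h1 : φ x = φ z)
      (h2 : φ y = φ w) : s(x, y) = s(z, w) := by
    have hc1 := (h x y hxy).1
    rcases hφeq x z h1 with rfl | ⟨rfl, rfl⟩ | ⟨rfl, rfl⟩ <;>
      rcases hφeq y w h2 with rfl | ⟨rfl, rfl⟩ | ⟨rfl, rfl⟩
    · rfl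
    · exact absurd hzw (hab x hxy)
    · exact absurd hxy (hab x hzw)
    · exact absurd (Sym2.eq_swap ▸ hzw) (hab y (Sym2.eq_swap ▸ hxy))
    · exact absurd rfl hc1
    · exact absurd hcol hc1
    · exact absurd (Sym2.eq_swap ▸ hxy) (hab y (Sym2.eq_swap ▸ hzw))
    · exact absurd hcol.symm hc1
    · exact absurd rfl hc1
  refine Finset.card_image_of_injOn fun e he f hf hef => ?_
  induction e using Sym2.ind with
  | _ x y =>
    induction f using Sym2.ind with
    | _ z w =>
      simp only [Sym2.map_mk, Sym2.eq_iff] at hef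
      rcases hef with ⟨h1, h2⟩ | ⟨h1, h2⟩
      · exact main x y z w he hf h1 h2
      · rw [main x y w z he (Sym2.eq_swap ▸ hf) h1 h2, Sym2.eq_swap]

theorem image_contract [DecidableEq W] (h : IsBipartiteOn col S E) {a b : W}
    (hcol : col a = col b) (haS : a ∈ S) (hab : a ≠ b) :
    IsBipartiteOn col (S.erase b) (E.image (Sym2.map (Function.update id b a))) := by
  set φ : W → W := Function.update id b a with hφ
  have hφb : φ b = a := by simp [hφ]
  have hφne (x : W) (hx : x ≠ b) : φ x = x := by simp [hφ, Function.update_of_ne hx]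
  have hcolφ (x : W) : col (φ x) = col x := by
    by_cases hx : x = b
    · rw [hx, hφb, hcol]
    · rw [hφne x hx]
  have hS (x : W) (hx : x ∈ S) : φ x ∈ S.erase b := by
    by_cases hxb : x = b
    · rw [hxb, hφb]; exact Finset.mem_erase.2 ⟨hab, haS⟩
    · rw [hφne x hxb]; exact Finset.mem_erase.2 ⟨hxb, hx⟩
  have main (x y : W) (hxy : s(x, y) ∈ E) :
      col (φ x) ≠ col (φ y) ∧ φ x ∈ S.erase b ∧ φ y ∈ S.erase b := by
    obtain ⟨h1, h2, h3⟩ := h x y hxy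
    exact ⟨by rwa [hcolφ, hcolφ], hS x h2, hS y h3⟩
  intro x y hxy
  obtain ⟨e, he, hexy⟩ := Finset.mem_image.1 hxy
  induction e using Sym2.ind with
  | _ p q =>
    simp only [Sym2.map_mk, Sym2.eq_iff] at hexy
    rcases hexy with ⟨rfl, rfl⟩ | ⟨rfl, rfl⟩
    · exact main p q he
    · exact main q p (Sym2.eq_swap ▸ he)

theorem injective_vec3 {α : Type*} {x y z : α} (hxy : x ≠ y) (hxz : x ≠ z) (hyz : y ≠ z) :
    Function.Injective ![x, y, z] := by
  intro i j hij
  fin_cases i <;> fin_cases j <;> simp_all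

set_option maxHeartbeats 1000000 in
/-- The bound on the number of edges of a bipartite graph having a plane drawing in which
independent edges are disjoint. -/
theorem card_add_four_le [DecidableEq W] (h : IsBipartiteOn col S E) (hw : HasWeakDrawing E)
    (hS : 3 ≤ S.card) : E.card + 4 ≤ 2 * S.card := by
  classical
  induction hk : S.card using Nat.strong_induction_on generalizing S E with
  | _ k IH =>
    subst hk
    by_contra hlt
    obtain ⟨F, hFE, hF⟩ := Finset.exists_subset_card_eq (s := E) (n := 2 * S.card - 3) (by omega)
    replace h := h.mono hFE
    replace hw := hw.mono hFE
    clear hlt hFE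
    clear E
    rename' F => E
    have ih : ∀ T : Finset W, T.card < S.card → 3 ≤ T.card → ∀ F, HasWeakDrawing F →
        IsBipartiteOn col T F → F.card + 4 ≤ 2 * T.card :=
      fun T hT hT3 F hwF hF => IH _ hT hF hwF hT3 rfl
    have hS4 : 4 ≤ S.card := by
      by_contra hS4
      have := h.card_le_two_of_card_eq_three (by omega)
      omega
    have hdeg : ∀ v ∈ S, 3 ≤ (E.filter (v ∈ ·)).card := by
      intro v hv
      by_contra hlt
      have h1 := Finset.card_filter_add_card_filter_not (s := E) (fun e => v ∈ e)
      have h2 : (S.erase v).card = S.card - 1 := Finset.card_erase_of_mem hv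
      have := ih (S.erase v) (by omega) (by omega) (E.filter (v ∉ ·))
        (hw.mono (Finset.filter_subset _ _)) (h.restrict (Finset.filter_subset _ _)
          fun e he x hx hxS => Finset.mem_erase.2
            ⟨fun hxv => (Finset.mem_filter.1 he).2 (hxv ▸ hx), hxS⟩)
      omega
    have hnbr : ∀ x ∈ S, ∀ t, ∃ z ≠ t, s(x, z) ∈ E := fun x hx t =>
      exists_neighbor_ne (by have := hdeg x hx; omega) t
    obtain ⟨v, hvS, hv3⟩ : ∃ v ∈ S, (E.filter (v ∈ ·)).card = 3 := by
      by_contra hne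
      push Not at hne
      have := Finset.sum_le_sum (s := S) (f := fun _ => 4)
        (g := fun v => (E.filter (v ∈ ·)).card) fun v hv => by
          have := hdeg v hv
          have := hne v hv
          show 4 ≤ (E.filter (v ∈ ·)).card
          omega
      rw [h.sum_degree] at this
      simp at this
      omega
    obtain ⟨e₁, e₂, e₃, h12, h13, h23, hE3⟩ := Finset.card_eq_three.1 hv3
    have hmem (e : Sym2 W) (he : e ∈ ({e₁, e₂, e₃} : Finset (Sym2 W))) : ∃ z, e = s(v, z) ∧
        s(v, z) ∈ E := by
      rw [← hE3, Finset.mem_filter] at he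
      obtain ⟨z, rfl⟩ := Sym2.mem_iff_exists.1 he.2
      exact ⟨z, rfl, he.1⟩
    obtain ⟨a, rfl, hva⟩ := hmem e₁ (by simp)
    obtain ⟨b, rfl, hvb⟩ := hmem e₂ (by simp)
    obtain ⟨c, rfl, hvc⟩ := hmem e₃ (by simp)
    have hab : a ≠ b := fun h => h12 (h ▸ rfl)
    have hac : a ≠ c := fun h => h13 (h ▸ rfl)
    have hbc : b ≠ c := fun h => h23 (h ▸ rfl)
    have hcab : col a = col b := by
      have h1 := (h _ _ hva).1
      have h2 := (h _ _ hvb).1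
      revert h1 h2; cases col a <;> cases col b <;> cases col v <;> simp
    have hcac : col c = col a := by
      have h1 := (h _ _ hva).1
      have h2 := (h _ _ hvc).1
      revert h1 h2; cases col a <;> cases col c <;> cases col v <;> simp
    have haS := (h _ _ hva).2.2
    have hbS := (h _ _ hvb).2.2
    have hcS := (h _ _ hvc).2.2
    set N := S.filter (fun w => s(w, a) ∈ E ∧ s(w, b) ∈ E) with hN
    have hvN : v ∈ N := Finset.mem_filter.2 ⟨hvS, hva, hvb⟩
    by_cases hcn : N.card ≤ 2
    · -- contraction of the path `a - v - b`
      have hcard : (N.erase v).card ≤ 1 := by rw [Finset.card_erase_of_mem hvN]; omega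
      set E₁ := (E.filter (v ∉ ·)) \ (N.erase v).image (fun w => s(w, b)) with hE₁
      have hE₁E : E₁ ⊆ E := Finset.sdiff_subset.trans (Finset.filter_subset _ _)
      have hvE₁ : ∀ e ∈ E₁, v ∉ e := fun e he =>
        (Finset.mem_filter.1 (Finset.mem_sdiff.1 he).1).2
      have hE₁c : E.card ≤ E₁.card + 4 := by
        have h1 := Finset.card_filter_add_card_filter_not (s := E) (fun e => v ∈ e)
        have h2 : (E.filter (v ∉ ·)).card - ((N.erase v).image (fun w => s(w, b))).card ≤ E₁.card :=
          Finset.le_card_sdiff _ _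
        have h3 : ((N.erase v).image (fun w => s(w, b))).card ≤ 1 :=
          Finset.card_image_le.trans hcard
        omega
      have hcE : (E₁.image (Sym2.map (Function.update id b a))).card = E₁.card := by
        refine (h.mono hE₁E).card_image_contract hcab hab fun w hwa hwb => ?_
        have hwv : w ≠ v := fun hwv => hvE₁ _ hwa (hwv ▸ by simp)
        refine (Finset.mem_sdiff.1 hwb).2 (Finset.mem_image.2 ⟨w, ?_, rfl⟩)
        exact Finset.mem_erase.2 ⟨hwv, Finset.mem_filter.2
          ⟨(h _ _ (hE₁E hwa)).2.1, hE₁E hwa, hE₁E hwb⟩⟩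
      have hres : IsBipartiteOn col (S.erase v) E₁ := h.restrict hE₁E fun e he x hx hxS =>
        Finset.mem_erase.2 ⟨fun hxv => hvE₁ e he (hxv ▸ hx), hxS⟩
      have hSc : ((S.erase v).erase b).card + 2 = S.card := by
        rw [Finset.card_erase_of_mem (Finset.mem_erase.2 ⟨(h.ne hvb).symm, hbS⟩),
          Finset.card_erase_of_mem hvS]
        omega
      obtain ⟨z, hzv, haz⟩ := hnbr a haS v
      have hS3 : 3 ≤ ((S.erase v).erase b).card := by
        have hzcol := (h _ _ haz).1
        have hza : a ≠ z := h.ne haz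
        have hzc : c ≠ z := fun e => hzcol (by rw [← e, hcac])
        have hzb : b ≠ z := fun e => hzcol (by rw [← e, hcab])
        rw [← show ({a, c, z} : Finset W).card = 3 from Finset.card_eq_three.2
          ⟨a, c, z, hac, hza, hzc, rfl⟩]
        refine Finset.card_le_card ?_
        simp [Finset.insert_subset_iff, hab, hbc.symm, hzb.symm, hzv, haS, hcS,
          (h.ne hva).symm, (h.ne hvc).symm, (h _ _ haz).2.2]
      have := ih _ (by omega) hS3 _ (hw.contract hva hvb hE₁E hvE₁)
        (hres.image_contract hcab (Finset.mem_erase.2 ⟨(h.ne hva).symm, haS⟩) hab)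
      omega
    · obtain ⟨p, hp, p', hp', hpp⟩ := Finset.one_lt_card.1
        (show 1 < (N.erase v).card by rw [Finset.card_erase_of_mem hvN]; omega)
      simp only [hN, Finset.mem_erase, Finset.mem_filter] at hp hp'
      obtain ⟨hpv, hpS, hpa, hpb⟩ := hp
      obtain ⟨hpv', hpS', hpa', hpb'⟩ := hp'
      set Y := S \ {a, b, v, p, p'} with hY
      set R : W → W → Prop := fun x z => s(x, z) ∈ E ∧ x ∈ Y ∧ z ∈ Y with hR
      set Y₀ := Y.filter (fun y => Relation.ReflTransGen R c y) with hY₀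
      have hcp : c ≠ p := fun e => (h _ _ hpa).1 (by rw [← e, hcac])
      have hcp' : c ≠ p' := fun e => (h _ _ hpa').1 (by rw [← e, hcac])
      have hcY : c ∈ Y := by
        simp [hY, hcS, hac.symm, hbc.symm, (h.ne hvc).symm, hcp, hcp']
      have hcY₀ : c ∈ Y₀ := Finset.mem_filter.2 ⟨hcY, .refl⟩
      have hYsub : Y₀ ⊆ Y := Finset.filter_subset _ _
      have hnot (x : W) (hx : x ∈ Y₀) : x ≠ a ∧ x ≠ b ∧ x ≠ v ∧ x ≠ p ∧ x ≠ p' := by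
        have := hYsub hx
        simp only [hY, Finset.mem_sdiff, Finset.mem_insert, Finset.mem_singleton] at this
        tauto
      have hstep (x y : W) (hxy : s(x, y) ∈ E) (hx : x ∈ Y₀) :
          y ∈ Y₀ ∨ y = a ∨ y = b ∨ y = v ∨ y = p ∨ y = p' := by
        by_cases hy : y ∈ Y
        · exact Or.inl (Finset.mem_filter.2 ⟨hy, (Finset.mem_filter.1 hx).2.tail
            ⟨hxy, hYsub hx, hy⟩⟩)
        · simp only [hY, Finset.mem_sdiff, Finset.mem_insert, Finset.mem_singleton,
            (h _ _ hxy).2.2, true_and, not_not] at hy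
          exact Or.inr hy
      have hadj (q q' : W) (hqq : (q = p ∧ q' = p') ∨ (q = p' ∧ q' = p)) :
          ∃ y ∈ Y₀, s(y, q') ∈ E := by
        by_contra hno
        push Not at hno
        have hqS : q ∈ S := by rcases hqq with ⟨rfl, -⟩ | ⟨rfl, -⟩ <;> assumption
        have hqS' : q' ∈ S := by rcases hqq with ⟨-, rfl⟩ | ⟨-, rfl⟩ <;> assumption
        have hqa : s(q, a) ∈ E := by rcases hqq with ⟨rfl, -⟩ | ⟨rfl, -⟩ <;> assumption
        have hqb : s(q, b) ∈ E := by rcases hqq with ⟨rfl, -⟩ | ⟨rfl, -⟩ <;> assumption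
        have hqa' : s(q', a) ∈ E := by rcases hqq with ⟨-, rfl⟩ | ⟨-, rfl⟩ <;> assumption
        have hqb' : s(q', b) ∈ E := by rcases hqq with ⟨-, rfl⟩ | ⟨-, rfl⟩ <;> assumption
        have hqv : q ≠ v := by rcases hqq with ⟨rfl, -⟩ | ⟨rfl, -⟩ <;> assumption
        have hqv' : q' ≠ v := by rcases hqq with ⟨-, rfl⟩ | ⟨-, rfl⟩ <;> assumption
        have hqq' : q ≠ q' := by
          rcases hqq with ⟨rfl, rfl⟩ | ⟨rfl, rfl⟩
          exacts [hpp, hpp.symm]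
        have hstep' (x y : W) (hxy : s(x, y) ∈ E) (hx : x ∈ Y₀) :
            y ∈ Y₀ ∨ y = a ∨ y = b ∨ y = v ∨ y = q ∨ y = q' := by
          have := hstep x y hxy hx
          rcases hqq with ⟨rfl, rfl⟩ | ⟨rfl, rfl⟩ <;> tauto
        have hnot' (x : W) (hx : x ∈ Y₀) : x ≠ q ∧ x ≠ q' := by
          have := hnot x hx
          rcases hqq with ⟨rfl, rfl⟩ | ⟨rfl, rfl⟩ <;> tauto
        have hCcard : ({a, b, v, q} : Finset W).card = 4 := by
          rw [Finset.card_insert_of_notMem, Finset.card_insert_of_notMem,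
            Finset.card_pair hqv.symm]
          · simp [(h.ne hvb).symm, (h.ne hqb).symm]
          · simp [hab, (h.ne hva).symm, (h.ne hqa).symm]
        have hQcard : ({s(v, a), s(v, b), s(q, a), s(q, b)} : Finset (Sym2 W)).card = 4 := by
          rw [Finset.card_insert_of_notMem, Finset.card_insert_of_notMem, Finset.card_pair]
          · simp [hab, h.ne hqb]
          · simp [hqv.symm, h.ne hvb, (h.ne hqb).symm]
          · simp [hab, hqv.symm, h.ne hva, h.ne hvb]
        have := h.card_add_four_le_of_separation
          (fun T hT hT3 F hFE hF => ih T hT hT3 F (hw.mono hFE) hF) {a, b, v, q} Y₀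
          (by simp [Finset.insert_subset_iff, haS, hbS, hvS, hqS])
          (hYsub.trans Finset.sdiff_subset) hCcard
          (Finset.disjoint_left.2 fun x hx hxC => by
            have h1 := hnot x hx
            have h2 := hnot' x hx
            simp only [Finset.mem_insert, Finset.mem_singleton] at hxC
            tauto)
          ⟨c, hcY₀⟩
          (fun x y hxy hx => by
            simp only [Finset.mem_insert, Finset.mem_singleton]
            rcases hstep' x y hxy hx with h1 | h1 | h1 | h1 | h1 | h1
            · exact Or.inl h1
            · exact Or.inr (by tauto)
            · exact Or.inr (by tauto)
            · exact Or.inr (by tauto)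
            · exact Or.inr (by tauto)
            · exact absurd (h1 ▸ hxy) (hno x hx))
          ⟨q', hqS', fun hh => (hnot' q' hh).2 rfl, by
            simp [hqv', hqq'.symm, h.ne hqa', h.ne hqb']⟩
          {s(v, a), s(v, b), s(q, a), s(q, b)} hQcard
          (by simp [Finset.insert_subset_iff, hva, hvb, hqa, hqb])
          (by
            intro e he x hx
            simp only [Finset.mem_insert, Finset.mem_singleton] at he ⊢
            rcases he with rfl | rfl | rfl | rfl <;> rcases Sym2.mem_iff.1 hx with rfl | rfl <;>
              simp)
        omega
      obtain ⟨y₁, hy₁, hyp₁⟩ := hadj p' p (Or.inr ⟨rfl, rfl⟩)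
      obtain ⟨y₂, hy₂, hyp₂⟩ := hadj p p' (Or.inl ⟨rfl, rfl⟩)
      have hout (x : W) (hx : x ∈ ({a, b, v, p, p'} : Finset W)) : x ∉ (Y : Set W) := by
        intro hh
        exact (Finset.mem_sdiff.1 (Finset.mem_coe.1 hh)).2 hx
      refine h.not_K33 hw (a := a) (b := b) (c := c) (v := ![v, p, p']) (y := ![c, y₁, y₂])
        (Y := Y) hab ?_ ?_ ?_ (hout a (by simp)) (hout b (by simp)) ?_ hcY (hnbr c hcS) hcac ?_ ?_
      · exact injective_vec3 hpv.symm hpv'.symm hpp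
      · intro i; fin_cases i
        exacts [Sym2.eq_swap ▸ hva, Sym2.eq_swap ▸ hpa, Sym2.eq_swap ▸ hpa']
      · intro i; fin_cases i
        exacts [Sym2.eq_swap ▸ hvb, Sym2.eq_swap ▸ hpb, Sym2.eq_swap ▸ hpb']
      · intro i; fin_cases i
        exacts [hout v (by simp), hout p (by simp), hout p' (by simp)]
      · intro i; fin_cases i
        exacts [Sym2.eq_swap ▸ hvc, hyp₁, hyp₂]
      · intro i; fin_cases i
        exacts [.refl, (Finset.mem_filter.1 hy₁).2, (Finset.mem_filter.1 hy₂).2]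

end IsBipartiteOn

namespace CrossingBlocks

variable {N P : Type*} [DecidableEq N]

/-- A pair of nodes joined by a point, or the three nodes of a path consisting of two points. -/
def IsBlock (ends : P → Sym2 N) (X : Finset P) (b : Finset N) : Prop :=
  (∃ e f, ∃ p ∈ X, e ≠ f ∧ ends p = s(e, f) ∧ b = {e, f}) ∨
    ∃ e f g, ∃ p ∈ X, ∃ q ∈ X, e ≠ f ∧ f ≠ g ∧ e ≠ g ∧ ends p = s(e, f) ∧ ends q = s(f, g) ∧
      b = {e, f, g}

theorem IsBlock.mono {ends : P → Sym2 N} {X Y : Finset P} {b : Finset N}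
    (h : IsBlock ends X b) (hXY : X ⊆ Y) : IsBlock ends Y b := by
  rcases h with ⟨e, f, p, hp, h⟩ | ⟨e, f, g, p, hp, q, hq, h⟩
  · exact Or.inl ⟨e, f, p, hXY hp, h⟩
  · exact Or.inr ⟨e, f, g, p, hXY hp, q, hXY hq, h⟩

theorem IsBlock.exists_mem {ends : P → Sym2 N} {X : Finset P} {b : Finset N}
    (h : IsBlock ends X b) {e : N} (he : e ∈ b) : ∃ p ∈ X, e ∈ ends p := by
  rcases h with ⟨x, y, p, hp, -, hpe, rfl⟩ | ⟨x, y, z, p, hp, q, hq, -, -, -, hpe, hqe, rfl⟩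
  · exact ⟨p, hp, by rw [hpe]; simpa using he⟩
  · simp only [Finset.mem_insert, Finset.mem_singleton] at he
    rcases he with rfl | rfl | rfl
    · exact ⟨p, hp, by simp [hpe]⟩
    · exact ⟨p, hp, by simp [hpe]⟩
    · exact ⟨q, hq, by simp [hqe]⟩

theorem IsBlock.nonempty {ends : P → Sym2 N} {X : Finset P} {b : Finset N}
    (h : IsBlock ends X b) : b.Nonempty := by
  rcases h with ⟨x, y, p, hp, -, hpe, rfl⟩ | ⟨x, y, z, p, hp, q, hq, -, -, -, hpe, hqe, rfl⟩ <;>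
    simp

/-- `Bs` is a family of disjoint blocks, no two of which are joined by a point. -/
structure IsBlockFamily (ends : P → Sym2 N) (X : Finset P) (Bs : Finset (Finset N)) : Prop where
  isBlock : ∀ b ∈ Bs, IsBlock ends X b
  disjoint : ∀ b ∈ Bs, ∀ b' ∈ Bs, b ≠ b' → Disjoint b b'
  not_joined : ∀ b ∈ Bs, ∀ b' ∈ Bs, b ≠ b' → ∀ e ∈ b, ∀ f ∈ b', ∀ p ∈ X, ends p ≠ s(e, f)

/-- There is a block family of large total size. -/
def HasLargeFamily (ends : P → Sym2 N) (X : Finset P) : Prop :=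
  ∃ Bs, IsBlockFamily ends X Bs ∧ 3 * X.card ≤ 5 * ∑ b ∈ Bs, b.card ∧
    ((∃ e, (X.filter (e ∈ ends ·)).card = 1) → 3 * X.card + 6 ≤ 5 * ∑ b ∈ Bs, b.card)

theorem card_le_add_of_removed {ends : P → Sym2 N} {X T : Finset P} {R : Finset N}
    (hT : ∀ p ∈ X, ∀ e ∈ R, e ∈ ends p → p ∈ T) :
    X.card ≤ (X.filter (fun p => ∀ e ∈ R, e ∉ ends p)).card + T.card := by
  rw [← Finset.card_filter_add_card_filter_not (s := X) (fun p => ∀ e ∈ R, e ∉ ends p)]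
  gcongr
  intro p hp
  obtain ⟨hpX, hp⟩ := Finset.mem_filter.1 hp
  push Not at hp
  obtain ⟨e, he, hep⟩ := hp
  exact hT p hpX e he hep

theorem HasLargeFamily.insert_block {ends : P → Sym2 N} {X T : Finset P} {R b : Finset N}
    (h : HasLargeFamily ends (X.filter (fun p => ∀ e ∈ R, e ∉ ends p)))
    (hb : IsBlock ends X b) (hbR : b ⊆ R)
    (hclosed : ∀ p ∈ X, ∀ e ∈ b, e ∈ ends p → ∀ f ∈ ends p, f ∈ R)
    (hT : ∀ p ∈ X, ∀ e ∈ R, e ∈ ends p → p ∈ T)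
    (hcount : 3 * T.card + 6 ≤ 5 * b.card ∨ (3 * T.card ≤ 5 * b.card ∧
      ((∃ e, ((X.filter (fun p => ∀ e ∈ R, e ∉ ends p)).filter (e ∈ ends ·)).card = 1) ∨
        ¬ ∃ e, (X.filter (e ∈ ends ·)).card = 1))) :
    HasLargeFamily ends X := by
  obtain ⟨Bs, hBs, h1, h2⟩ := h
  have hsub := Finset.filter_subset (fun p => ∀ e ∈ R, e ∉ ends p) X
  have hR (b' : Finset N) (hb' : b' ∈ Bs) (e : N) (he : e ∈ b') : e ∉ R := by
    obtain ⟨p, hp, hep⟩ := (hBs.isBlock b' hb').exists_mem he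
    exact fun heR => (Finset.mem_filter.1 hp).2 e heR hep
  have hdisj (b' : Finset N) (hb' : b' ∈ Bs) : Disjoint b b' :=
    Finset.disjoint_left.2 fun e he he' => hR b' hb' e he' (hbR he)
  have hnj (b' : Finset N) (hb' : b' ∈ Bs) (e : N) (he : e ∈ b) (f : N) (hf : f ∈ b') (p : P)
      (hp : p ∈ X) : ends p ≠ s(e, f) := fun hpe =>
    hR b' hb' f hf (hclosed p hp e he (by simp [hpe]) f (by simp [hpe]))
  have hbBs : b ∉ Bs := fun hh => by
    obtain ⟨e, he⟩ := hb.nonempty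
    exact hR b hh e he (hbR he)
  have hcard := card_le_add_of_removed hT
  refine ⟨insert b Bs, ⟨?_, ?_, ?_⟩, ?_, ?_⟩
  · intro b' hb'
    rcases Finset.mem_insert.1 hb' with rfl | hb'
    · exact hb
    · exact (hBs.isBlock b' hb').mono hsub
  · intro b₁ hb₁ b₂ hb₂ hne
    rcases Finset.mem_insert.1 hb₁ with rfl | hm₁ <;> rcases Finset.mem_insert.1 hb₂ with rfl | hm₂
    · exact absurd rfl hne
    · exact hdisj _ hm₂
    · exact (hdisj _ hm₁).symm
    · exact hBs.disjoint _ hm₁ _ hm₂ hne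
  · intro b₁ hb₁ b₂ hb₂ hne e he f hf p hp hpe
    rcases Finset.mem_insert.1 hb₁ with rfl | hm₁ <;> rcases Finset.mem_insert.1 hb₂ with rfl | hm₂
    · exact absurd rfl hne
    · exact hnj _ hm₂ e he f hf p hp hpe
    · exact hnj _ hm₁ f hf e he p hp (hpe.trans Sym2.eq_swap)
    · refine hBs.not_joined _ hm₁ _ hm₂ hne e he f hf p (Finset.mem_filter.2 ⟨hp, ?_⟩) hpe
      intro x hx hxp
      rw [hpe] at hxp
      rcases Sym2.mem_iff.1 hxp with rfl | rfl
      · exact hR _ hm₁ _ he hx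
      · exact hR _ hm₂ _ hf hx
  · rw [Finset.sum_insert hbBs]
    rcases hcount with h | ⟨h, -⟩ <;> omega
  · intro hdeg
    rw [Finset.sum_insert hbBs]
    rcases hcount with h | ⟨h, h' | h'⟩
    · omega
    · have := h2 h'
      omega
    · exact absurd hdeg h'

theorem filter_eq_singleton_or_pair [DecidableEq P] {ends : P → Sym2 N} {X : Finset P} {e : N}
    {p : P} (hdeg : (X.filter (fun p => e ∈ ends p)).card ≤ 2)
    (hp : p ∈ X.filter (fun p => e ∈ ends p)) :
    X.filter (fun p => e ∈ ends p) = {p} ∨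
      ∃ q ∈ X, e ∈ ends q ∧ q ≠ p ∧ X.filter (fun p => e ∈ ends p) = {p, q} := by
  have hpos : 0 < (X.filter (fun p => e ∈ ends p)).card := Finset.card_pos.2 ⟨p, hp⟩
  rcases (by omega : (X.filter (fun p => e ∈ ends p)).card = 1 ∨
      (X.filter (fun p => e ∈ ends p)).card = 2) with h | h
  · obtain ⟨q, hq⟩ := Finset.card_eq_one.1 h
    left
    rw [hq] at hp ⊢
    rw [Finset.mem_singleton.1 hp]
  · right
    obtain ⟨x, y, hxy, hs⟩ := Finset.card_eq_two.1 h
    have hx : x ∈ X.filter (fun p => e ∈ ends p) := by rw [hs]; simp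
    have hy : y ∈ X.filter (fun p => e ∈ ends p) := by rw [hs]; simp
    rw [hs] at hp
    rcases Finset.mem_insert.1 hp with rfl | hp
    · exact ⟨y, (Finset.mem_filter.1 hy).1, (Finset.mem_filter.1 hy).2, hxy.symm, hs⟩
    · rw [Finset.mem_singleton.1 hp] at *
      exact ⟨x, (Finset.mem_filter.1 hx).1, (Finset.mem_filter.1 hx).2, hxy,
        by rw [hs, Finset.pair_comm]⟩

theorem exists_other {N P : Type*} {ends : P → Sym2 N} {e : N} {p : P} (h : e ∈ ends p)
    (hd : ¬ (ends p).IsDiag) : ∃ f, f ≠ e ∧ ends p = s(e, f) := by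
  obtain ⟨f, hf⟩ := Sym2.mem_iff_exists.1 h
  exact ⟨f, fun hh => hd (by rw [hf, hh]; simp), hf⟩

theorem hasLargeFamily [DecidableEq P] (ends : P → Sym2 N) (X : Finset P)
    (hdiag : ∀ p ∈ X, ¬ (ends p).IsDiag)
    (hdeg : ∀ e, (X.filter (fun p => e ∈ ends p)).card ≤ 2) : HasLargeFamily ends X := by
  induction X using Finset.strongInduction with
  | H X IH =>
    have ih (R : Finset N) (e : N) (he : e ∈ R) (p : P) (hp : p ∈ X) (hep : e ∈ ends p) :
        HasLargeFamily ends (X.filter (fun p => ∀ e ∈ R, e ∉ ends p)) :=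
      IH _ (Finset.filter_ssubset.2 ⟨p, hp, fun h => h e he hep⟩)
        (fun p hp => hdiag p (Finset.filter_subset _ _ hp))
        (fun e => (Finset.card_le_card (Finset.filter_subset_filter _
          (Finset.filter_subset _ _))).trans (hdeg e))
    have hst {e : N} {T : Finset P} (hs : X.filter (fun p => e ∈ ends p) = T) {p : P} (hp : p ∈ X)
        (hep : e ∈ ends p) : p ∈ T := hs ▸ Finset.mem_filter.2 ⟨hp, hep⟩
    by_cases hone : ∃ e, (X.filter (fun p => e ∈ ends p)).card = 1
    · obtain ⟨e₁, he₁⟩ := hone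
      obtain ⟨p₁, hs₁⟩ := Finset.card_eq_one.1 he₁
      obtain ⟨hp₁, hep₁⟩ : p₁ ∈ X ∧ e₁ ∈ ends p₁ :=
        Finset.mem_filter.1 (hs₁ ▸ Finset.mem_singleton_self p₁)
      obtain ⟨e₂, h21, hp₁e⟩ := exists_other hep₁ (hdiag _ hp₁)
      rcases filter_eq_singleton_or_pair (hdeg e₂) (p := p₁)
          (Finset.mem_filter.2 ⟨hp₁, by simp [hp₁e]⟩) with
        hs₂ | ⟨p₂, hp₂, hep₂, hp21, hs₂⟩
      · refine (ih {e₁, e₂} e₁ (by simp) p₁ hp₁ hep₁).insert_block (T := {p₁}) (b := {e₁, e₂})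
          (Or.inl ⟨e₁, e₂, p₁, hp₁, h21.symm, hp₁e, rfl⟩) subset_rfl ?_ ?_ ?_
        · intro p hp e he hep f hf
          have : p = p₁ := by
            simp only [Finset.mem_insert, Finset.mem_singleton] at he
            rcases he with rfl | rfl
            · simpa using hst hs₁ hp hep
            · simpa using hst hs₂ hp hep
          rw [this, hp₁e] at hf
          simpa using hf
        · intro p hp e he hep
          simp only [Finset.mem_insert, Finset.mem_singleton] at he
          rcases he with rfl | rfl
          · exact hst hs₁ hp hep
          · exact hst hs₂ hp hep
        · left
          rw [Finset.card_pair h21.symm]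
          simp
      obtain ⟨e₃, h32, hp₂e⟩ := exists_other hep₂ (hdiag _ hp₂)
      have h31 : e₃ ≠ e₁ := fun h => hp21 (by simpa using hst hs₁ hp₂ (by simp [hp₂e, h]))
      have hb₃ : IsBlock ends X {e₁, e₂, e₃} :=
        Or.inr ⟨e₁, e₂, e₃, p₁, hp₁, p₂, hp₂, h21.symm, h32.symm, h31.symm, hp₁e, hp₂e, rfl⟩
      have hc₃ : ({e₁, e₂, e₃} : Finset N).card = 3 :=
        Finset.card_eq_three.2 ⟨e₁, e₂, e₃, h21.symm, h31.symm, h32.symm, rfl⟩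
      rcases filter_eq_singleton_or_pair (hdeg e₃) (p := p₂)
          (Finset.mem_filter.2 ⟨hp₂, by simp [hp₂e]⟩) with
        hs₃ | ⟨p₃, hp₃, hep₃, hp32, hs₃⟩
      · refine (ih {e₁, e₂, e₃} e₁ (by simp) p₁ hp₁ hep₁).insert_block (T := {p₁, p₂}) hb₃
          subset_rfl ?_ ?_ ?_
        · intro p hp e he hep f hf
          have : p = p₁ ∨ p = p₂ := by
            simp only [Finset.mem_insert, Finset.mem_singleton] at he
            rcases he with rfl | rfl | rfl
            · exact Or.inl (by simpa using hst hs₁ hp hep)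
            · simpa using hst hs₂ hp hep
            · exact Or.inr (by simpa using hst hs₃ hp hep)
          rcases this with rfl | rfl
          · rw [hp₁e] at hf
            rcases Sym2.mem_iff.1 hf with rfl | rfl <;> simp
          · rw [hp₂e] at hf
            rcases Sym2.mem_iff.1 hf with rfl | rfl <;> simp
        · intro p hp e he hep
          simp only [Finset.mem_insert, Finset.mem_singleton] at he
          rcases he with rfl | rfl | rfl
          · have := hst hs₁ hp hep
            simp_all
          · exact hst hs₂ hp hep
          · have := hst hs₃ hp hep
            simp_all
        · left
          rw [hc₃]
          have := Finset.card_le_two (a := p₁) (b := p₂)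
          omega
      obtain ⟨e₄, h43, hp₃e⟩ := exists_other hep₃ (hdiag _ hp₃)
      have hp31 : p₃ ≠ p₁ := fun h => by
        rw [h, hp₁e] at hep₃
        rcases Sym2.mem_iff.1 hep₃ with h | h
        exacts [h31 h, h32 h]
      have h42 : e₄ ≠ e₂ := fun h => by
        have := hst hs₂ hp₃ (by simp [hp₃e, h])
        simp [hp31, hp32] at this
      have h41 : e₄ ≠ e₁ := fun h => hp31 (by simpa using hst hs₁ hp₃ (by simp [hp₃e, h]))
      rcases filter_eq_singleton_or_pair (hdeg e₄) (p := p₃)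
          (Finset.mem_filter.2 ⟨hp₃, by simp [hp₃e]⟩) with
        hs₄ | ⟨p₄, hp₄, hep₄, hp43, hs₄⟩
      · refine (ih {e₁, e₂, e₃, e₄} e₁ (by simp) p₁ hp₁ hep₁).insert_block
          (T := {p₁, p₂, p₃}) hb₃ (by intro x; simp; tauto) ?_ ?_ ?_
        · intro p hp e he hep f hf
          have : p = p₁ ∨ p = p₂ ∨ p = p₃ := by
            simp only [Finset.mem_insert, Finset.mem_singleton] at he
            rcases he with rfl | rfl | rfl
            · exact Or.inl (by simpa using hst hs₁ hp hep)
            · have := hst hs₂ hp hep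
              simp only [Finset.mem_insert, Finset.mem_singleton] at this
              tauto
            · exact Or.inr (by simpa using hst hs₃ hp hep)
          rcases this with rfl | rfl | rfl
          · rw [hp₁e] at hf
            rcases Sym2.mem_iff.1 hf with rfl | rfl <;> simp
          · rw [hp₂e] at hf
            rcases Sym2.mem_iff.1 hf with rfl | rfl <;> simp
          · rw [hp₃e] at hf
            rcases Sym2.mem_iff.1 hf with rfl | rfl <;> simp
        · intro p hp e he hep
          simp only [Finset.mem_insert, Finset.mem_singleton] at he ⊢
          rcases he with rfl | rfl | rfl | rfl
          · have := hst hs₁ hp hep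
            simp only [Finset.mem_singleton] at this
            tauto
          · have := hst hs₂ hp hep
            simp only [Finset.mem_insert, Finset.mem_singleton] at this
            tauto
          · have := hst hs₃ hp hep
            simp only [Finset.mem_insert, Finset.mem_singleton] at this
            tauto
          · have := hst hs₄ hp hep
            simp only [Finset.mem_singleton] at this
            tauto
        · left
          rw [hc₃]
          have := Finset.card_le_three (a := p₁) (b := p₂) (c := p₃)
          omega
      · refine (ih {e₁, e₂, e₃} e₁ (by simp) p₁ hp₁ hep₁).insert_block (T := {p₁, p₂, p₃})
          (b := {e₁, e₂}) (Or.inl ⟨e₁, e₂, p₁, hp₁, h21.symm, hp₁e, rfl⟩)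
          (by intro x; simp; tauto) ?_ ?_ ?_
        · intro p hp e he hep f hf
          have : p = p₁ ∨ p = p₂ := by
            simp only [Finset.mem_insert, Finset.mem_singleton] at he
            rcases he with rfl | rfl
            · exact Or.inl (by simpa using hst hs₁ hp hep)
            · simpa using hst hs₂ hp hep
          rcases this with rfl | rfl
          · rw [hp₁e] at hf
            rcases Sym2.mem_iff.1 hf with rfl | rfl <;> simp
          · rw [hp₂e] at hf
            rcases Sym2.mem_iff.1 hf with rfl | rfl <;> simp
        · intro p hp e he hep
          simp only [Finset.mem_insert, Finset.mem_singleton] at he ⊢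
          rcases he with rfl | rfl | rfl
          · have := hst hs₁ hp hep
            simp only [Finset.mem_singleton] at this
            tauto
          · have := hst hs₂ hp hep
            simp only [Finset.mem_insert, Finset.mem_singleton] at this
            tauto
          · have := hst hs₃ hp hep
            simp only [Finset.mem_insert, Finset.mem_singleton] at this
            tauto
        · right
          have := Finset.card_le_three (a := p₁) (b := p₂) (c := p₃)
          refine ⟨by rw [Finset.card_pair h21.symm]; omega, Or.inl ⟨e₄, ?_⟩⟩
          have hp41 : p₄ ≠ p₁ := fun h => by
            rw [h, hp₁e] at hep₄
            rcases Sym2.mem_iff.1 hep₄ with h | h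
            exacts [h41 h, h42 h]
          have hp42 : p₄ ≠ p₂ := fun h => by
            rw [h, hp₂e] at hep₄
            rcases Sym2.mem_iff.1 hep₄ with h | h
            exacts [h42 h, h43 h]
          rw [Finset.card_eq_one]
          refine ⟨p₄, Finset.ext fun p => ?_⟩
          simp only [Finset.mem_filter, Finset.mem_singleton]
          constructor
          · rintro ⟨⟨hp, hpR⟩, hep⟩
            have := hst hs₄ hp hep
            simp only [Finset.mem_insert, Finset.mem_singleton] at this
            rcases this with rfl | rfl
            · exact absurd hep₃ (hpR e₃ (by simp))
            · rfl
          · rintro rfl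
            refine ⟨⟨hp₄, fun e he hep => ?_⟩, hep₄⟩
            simp only [Finset.mem_insert, Finset.mem_singleton] at he
            rcases he with rfl | rfl | rfl
            · have := hst hs₁ hp₄ hep
              simp_all
            · have := hst hs₂ hp₄ hep
              simp_all
            · have := hst hs₃ hp₄ hep
              simp_all
    · rcases X.eq_empty_or_nonempty with rfl | ⟨p, hp⟩
      · exact ⟨∅, ⟨by simp, by simp, by simp⟩, by simp, by simp⟩
      obtain ⟨g, hg⟩ : ∃ g, g ∈ ends p := ⟨_, Sym2.out_fst_mem _⟩
      have htwo {e : N} {p : P} (hp : p ∈ X) (hep : e ∈ ends p) : ∃ q ∈ X, e ∈ ends q ∧ q ≠ p ∧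
          X.filter (fun p => e ∈ ends p) = {p, q} := by
        rcases filter_eq_singleton_or_pair (hdeg e) (Finset.mem_filter.2 ⟨hp, hep⟩) with h | h
        · exact absurd ⟨e, by rw [h]; simp⟩ hone
        · exact h
      obtain ⟨q, hq, hgq, hqp, hsg⟩ := htwo hp hg
      obtain ⟨x, hxg, hpx⟩ := exists_other hg (hdiag _ hp)
      obtain ⟨y, hyg, hqy⟩ := exists_other hgq (hdiag _ hq)
      obtain ⟨r, hr, hxr, hrp, hsx⟩ := htwo hp (e := x) (by simp [hpx])
      by_cases hxy : x = y
      · subst hxy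
        have hrq : r = q := by
          have := hst hsx hq (by simp [hqy])
          simp only [Finset.mem_insert, Finset.mem_singleton] at this
          tauto
        subst hrq
        have hT : ∀ s ∈ X, ∀ e ∈ ({g, x} : Finset N), e ∈ ends s → s ∈ ({p, r} : Finset P) := by
          intro s hs e he hes
          simp only [Finset.mem_insert, Finset.mem_singleton] at he
          rcases he with rfl | rfl
          · exact hst hsg hs hes
          · exact hst hsx hs hes
        refine (ih {g, x} g (by simp) p hp hg).insert_block (T := {p, r}) (b := {g, x})
          (Or.inl ⟨g, x, p, hp, hxg.symm, hpx, rfl⟩) subset_rfl ?_ hT ?_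
        · intro s hs e he hes f hf
          have := hT s hs e he hes
          simp only [Finset.mem_insert, Finset.mem_singleton] at this
          rcases this with rfl | rfl
          · rw [hpx] at hf; simpa using hf
          · rw [hqy] at hf; simpa using hf
        · right
          refine ⟨?_, Or.inr hone⟩
          rw [Finset.card_pair hxg.symm]
          have := Finset.card_le_two (a := p) (b := r)
          omega
      · obtain ⟨Bs, hBs, -, h2⟩ := ih {g} g (by simp) p hp hg
        have hsub := Finset.filter_subset (fun p => ∀ e ∈ ({g} : Finset N), e ∉ ends p) X
        have hT : ∀ s ∈ X, ∀ e ∈ ({g} : Finset N), e ∈ ends s → s ∈ ({p, q} : Finset P) := by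
          intro s hs e he hes
          rw [Finset.mem_singleton.1 he] at hes
          exact hst hsg hs hes
        have hcard := card_le_add_of_removed hT
        have h22 := Finset.card_le_two (a := p) (b := q)
        refine ⟨Bs, ⟨fun b hb => (hBs.isBlock b hb).mono hsub, hBs.disjoint, ?_⟩, ?_,
          fun h => absurd h hone⟩
        · intro b hb b' hb' hne e he f hf s hs hse
          refine hBs.not_joined b hb b' hb' hne e he f hf s (Finset.mem_filter.2 ⟨hs, ?_⟩) hse
          intro z hz hzs
          have hnot (b : Finset N) (hb : b ∈ Bs) (e : N) (he : e ∈ b) : e ≠ z := fun hez => by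
            obtain ⟨t, ht, het⟩ := (hBs.isBlock b hb).exists_mem he
            exact (Finset.mem_filter.1 ht).2 z hz (hez ▸ het)
          rw [hse] at hzs
          rcases Sym2.mem_iff.1 hzs with rfl | rfl
          · exact hnot b hb _ he rfl
          · exact hnot b' hb' _ hf rfl
        · have := h2 ⟨x, by
            rw [Finset.card_eq_one]
            refine ⟨r, Finset.ext fun s => ?_⟩
            simp only [Finset.mem_filter, Finset.mem_singleton]
            constructor
            · rintro ⟨⟨hs, hsR⟩, hxs⟩
              have := hst hsx hs hxs
              simp only [Finset.mem_insert, Finset.mem_singleton] at this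
              rcases this with rfl | rfl
              · exact absurd hg (hsR g rfl)
              · rfl
            · rintro rfl
              refine ⟨⟨hr, ?_⟩, hxr⟩
              rintro e rfl hes
              have := hst hsg hr hes
              simp only [Finset.mem_insert, Finset.mem_singleton] at this
              rcases this with h | rfl
              · exact hrp h
              · rw [hqy] at hxr
                rcases Sym2.mem_iff.1 hxr with h | h
                exacts [hxg h, hxy h]⟩
          omega

end CrossingBlocks

section DrawingArgument

open Set Topology

/-- `S` is the trace of a simple arc from `a` to `b`. -/
def IsArc {X : Type*} [TopologicalSpace X] (S : Set X) (a b : X) : Prop :=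
  ∃ γ : Path a b, Function.Injective γ ∧ range γ = S

namespace IsArc

variable {X : Type*} [TopologicalSpace X] {S T : Set X} {a b x : X}

lemma symm (h : IsArc S a b) : IsArc S b a := by
  obtain ⟨γ, hγ, rfl⟩ := h
  refine ⟨γ.symm, fun s t hst => ?_, γ.symm_range⟩
  have := hγ hst
  exact unitInterval.symm_bijective.1 this

lemma left_mem (h : IsArc S a b) : a ∈ S := by
  obtain ⟨γ, -, rfl⟩ := h
  exact ⟨0, γ.source⟩

lemma right_mem (h : IsArc S a b) : b ∈ S := h.symm.left_mem

lemma isCompact (h : IsArc S a b) : IsCompact S := by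
  obtain ⟨γ, -, rfl⟩ := h
  exact isCompact_range γ.continuous

lemma isPathConnected (h : IsArc S a b) : IsPathConnected S := by
  obtain ⟨γ, -, rfl⟩ := h
  rw [← image_univ]
  have : PathConnectedSpace I := isPathConnected_iff_pathConnectedSpace.1
    ((convex_Icc (0 : ℝ) 1).isPathConnected ⟨0, by simp⟩)
  exact isPathConnected_univ.image γ.continuous

lemma ne (h : IsArc S a b) : a ≠ b := by
  obtain ⟨γ, hγ, -⟩ := h
  intro hab
  have : γ 0 = γ 1 := by rw [γ.source, γ.target, hab]
  exact zero_ne_one (hγ this)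

lemma convexComb_injective {s t : I} (h : s < t) :
    Function.Injective (fun r : I => Icc.convexComb s t r) := by
  intro p q hpq
  have h1 := congrArg Subtype.val hpq
  simp only [Icc.coe_convexComb] at h1
  have h2 : (s : ℝ) < t := h
  apply Subtype.ext
  have : ((p : ℝ) - q) * (t - s) = 0 := by linarith
  rcases mul_eq_zero.1 this with h3 | h3 <;> linarith

lemma of_subpath {γ : Path a b} (hγ : Function.Injective γ) {s t : I} (h : s < t) :
    IsArc (γ '' Icc s t) (γ s) (γ t) :=
  ⟨γ.subpath s t, hγ.comp (convexComb_injective h), γ.range_subpath_of_le s t h.le⟩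

/-- Splitting the arc at a parameter. -/
lemma split_param {γ : Path a b} (hγ : Function.Injective γ) {t : I} (h0 : t ≠ 0) (h1 : t ≠ 1) :
    IsArc (γ '' Icc 0 t) a (γ t) ∧ IsArc (γ '' Icc t 1) (γ t) b ∧
      γ '' Icc 0 t ∪ γ '' Icc t 1 = range γ ∧ γ '' Icc 0 t ∩ γ '' Icc t 1 = {γ t} := by
  refine ⟨?_, ?_, ?_, ?_⟩
  · simpa using of_subpath hγ (s := 0) (t := t) (unitInterval.pos_iff_ne_zero.2 h0)
  · simpa using of_subpath hγ (s := t) (t := 1) (unitInterval.lt_one_iff_ne_one.2 h1)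
  · rw [← image_union, Icc_union_Icc_eq_Icc unitInterval.nonneg' unitInterval.le_one',
      ← image_univ]
    congr 1
    ext r
    simp [unitInterval.le_one']
  · rw [← image_inter hγ, Icc_inter_Icc_eq_singleton unitInterval.nonneg' unitInterval.le_one',
      image_singleton]

lemma split (h : IsArc S a b) (hx : x ∈ S) (hxa : x ≠ a) (hxb : x ≠ b) :
    ∃ S₁ S₂, IsArc S₁ a x ∧ IsArc S₂ x b ∧ S₁ ∪ S₂ = S ∧ S₁ ∩ S₂ = {x} := by
  obtain ⟨γ, hγ, rfl⟩ := h
  obtain ⟨t, rfl⟩ := hx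
  exact ⟨_, _, split_param hγ (by rintro rfl; simp at hxa) (by rintro rfl; simp at hxb)⟩

/-- The first point of an arc in a closed set. -/
lemma first_hit (h : IsArc S a b) {F : Set X} (hF : IsClosed F) (ha : a ∉ F)
    (hSF : (S ∩ F).Nonempty) :
    ∃ x ∈ F, ∃ S₁ ⊆ S, IsArc S₁ a x ∧ S₁ ∩ F = {x} ∧
      (x ≠ b → ∃ S₂, IsArc S₂ x b ∧ S₁ ∪ S₂ = S ∧ S₁ ∩ S₂ = {x}) := by
  obtain ⟨γ, hγ, rfl⟩ := h
  obtain ⟨_, ⟨t₀, rfl⟩, ht₀⟩ := hSF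
  have hcl : IsCompact (γ ⁻¹' F) := (hF.preimage γ.continuous).isCompact
  obtain ⟨t, ht, hmin⟩ := hcl.exists_isLeast ⟨t₀, ht₀⟩
  have h0 : t ≠ 0 := by
    rintro rfl
    exact ha (by simpa using ht)
  refine ⟨γ t, ht, γ '' Icc 0 t, image_subset_range _ _, ?_, ?_, fun hb => ?_⟩
  · simpa using of_subpath hγ (s := 0) (t := t) (unitInterval.pos_iff_ne_zero.2 h0)
  · ext y
    constructor
    · rintro ⟨⟨r, hr, rfl⟩, hy⟩
      have : r = t := le_antisymm hr.2 (hmin hy)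
      simp [this]
    · rintro rfl
      exact ⟨⟨t, ⟨unitInterval.nonneg', le_rfl⟩, rfl⟩, ht⟩
  · have := split_param hγ h0 (by rintro rfl; simp at hb)
    exact ⟨_, this.2⟩

lemma concat {S T : Set X} {a x b : X} (hS : IsArc S a x) (hT : IsArc T x b) (h : S ∩ T = {x}) :
    IsArc (S ∪ T) a b := by
  obtain ⟨γ, hγ, rfl⟩ := hS
  obtain ⟨δ, hδ, rfl⟩ := hT
  refine ⟨γ.trans δ, ?_, Path.trans_range γ δ⟩
  have key : ∀ s t : I, γ s = δ t → s = 1 ∧ t = 0 := by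
    intro s t hst
    have h1 : γ s ∈ range γ ∩ range δ := ⟨⟨s, rfl⟩, ⟨t, hst.symm⟩⟩
    rw [h, mem_singleton_iff] at h1
    exact ⟨hγ (h1.trans γ.target.symm), hδ (hst.symm.trans (h1.trans δ.source.symm))⟩
  intro s t hst
  rw [Path.trans_apply, Path.trans_apply] at hst
  apply Subtype.ext
  split_ifs at hst with h1 h2 h2
  · have := congrArg Subtype.val (hγ hst)
    simp only at this
    linarith
  · have h3 := congrArg Subtype.val (key _ _ hst).2
    simp only [Set.Icc.coe_zero] at h3
    linarith
  · have h3 := congrArg Subtype.val (key _ _ hst.symm).2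
    simp only [Set.Icc.coe_zero] at h3
    linarith
  · have := congrArg Subtype.val (hδ hst)
    simp only at this
    linarith

lemma of_segment {E : Type*} [AddCommGroup E] [Module ℝ E] [TopologicalSpace E]
    [IsTopologicalAddGroup E] [ContinuousSMul ℝ E] {a b : E} (hab : a ≠ b) :
    IsArc (segment ℝ a b) a b := by
  refine ⟨⟨⟨fun t => AffineMap.lineMap a b (t : ℝ), ?_⟩, by simp, by simp⟩, ?_, ?_⟩
  · exact AffineMap.lineMap_continuous.comp continuous_subtype_val
  · intro s t hst
    exact Subtype.ext (AffineMap.lineMap_injective ℝ hab hst)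
  · rw [segment_eq_image_lineMap]
    ext y
    simp

end IsArc

/-- Two arcs joined by a third one. -/
lemma IsArc.concat₃ {X : Type*} [TopologicalSpace X] {P M Q B : Set X} {u a b v : X}
    (hP : IsArc P u a) (hM : IsArc M a b) (hQ : IsArc Q b v) (hMB : M ⊆ B)
    (hPB : P ∩ B = {a}) (hQB : Q ∩ B = {b}) (hPQ : Disjoint P Q) :
    IsArc (P ∪ M ∪ Q) u v := by
  refine (hP.concat hM ?_).concat hQ ?_
  · refine Subset.antisymm ((inter_subset_inter_right _ hMB).trans hPB.subset) ?_
    rintro _ rfl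
    exact ⟨hP.right_mem, hM.left_mem⟩
  · refine Subset.antisymm ?_ ?_
    · rintro y ⟨hy | hy, hyQ⟩
      · exact absurd hyQ (disjoint_left.1 hPQ hy)
      · exact hQB.subset ⟨hyQ, hMB hy⟩
    · rintro _ rfl
      exact ⟨Or.inr hM.right_mem, hQ.left_mem⟩

lemma IsArc.exists_boundary_hit {X : Type*} [TopologicalSpace X] {S : Set X} {u x : X}
    (h : IsArc S u x) {g : X → ℝ} (hg : Continuous g) (hu : 0 < g u) (hx : g x ≤ 0) :
    ∃ a, g a = 0 ∧ ∃ S₁ ⊆ S, IsArc S₁ u a ∧ S₁ ∩ {y | g y ≤ 0} = {a} := by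
  obtain ⟨a, ha, S₁, hS₁, harc, hinter, -⟩ := h.first_hit (F := {y | g y ≤ 0})
    (isClosed_le hg continuous_const) (by simpa using hu) ⟨x, h.right_mem, hx⟩
  refine ⟨a, ?_, S₁, hS₁, harc, hinter⟩
  have hc : IsPreconnected S₁ := harc.isPathConnected.isConnected.isPreconnected
  obtain ⟨y, hy, hy0⟩ := hc.intermediate_value harc.right_mem harc.left_mem
    hg.continuousOn ⟨ha, hu.le⟩
  have : y ∈ S₁ ∩ {y | g y ≤ 0} := ⟨hy, hy0.le⟩
  rw [hinter, mem_singleton_iff] at this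
  rw [← this, hy0]

/-- The twice signed area of a triangle. -/
def signedArea (a b c : ℝ × ℝ) : ℝ :=
  (b.1 - a.1) * (c.2 - a.2) - (b.2 - a.2) * (c.1 - a.1)

/-- The squared Euclidean distance minus a squared radius. -/
def discFun (x : ℝ × ℝ) (r : ℝ) (p : ℝ × ℝ) : ℝ :=
  (p.1 - x.1) ^ 2 + (p.2 - x.2) ^ 2 - r ^ 2

lemma continuous_discFun (x : ℝ × ℝ) (r : ℝ) : Continuous (discFun x r) := by
  unfold discFun
  fun_prop

lemma signedArea_ne_zero {x : ℝ × ℝ} {r : ℝ} {a b c : ℝ × ℝ} (ha : discFun x r a = 0)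
    (hb : discFun x r b = 0) (hc : discFun x r c = 0) (hab : a ≠ b) (hac : a ≠ c) (hbc : b ≠ c) :
    signedArea a b c ≠ 0 := by
  intro h
  obtain ⟨a1, a2⟩ := a
  obtain ⟨b1, b2⟩ := b
  obtain ⟨c1, c2⟩ := c
  simp only [discFun, signedArea] at *
  obtain ⟨l, h1, h2⟩ : ∃ l : ℝ, c1 - a1 = l * (b1 - a1) ∧ c2 - a2 = l * (b2 - a2) := by
    by_cases h1 : b1 - a1 = 0
    · have h2 : b2 - a2 ≠ 0 := by
        intro h2
        exact hab (Prod.ext (by simp; linarith) (by simp; linarith))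
      refine ⟨(c2 - a2) / (b2 - a2), ?_, by field_simp⟩
      field_simp
      linarith
    · refine ⟨(c1 - a1) / (b1 - a1), by field_simp, ?_⟩
      field_simp
      linarith
  obtain rfl : c1 = a1 + l * (b1 - a1) := by linarith
  obtain rfl : c2 = a2 + l * (b2 - a2) := by linarith
  have key : l * (l - 1) * ((b1 - a1) ^ 2 + (b2 - a2) ^ 2) = 0 := by
    linear_combination hc - l * hb - (1 - l) * ha
  rcases mul_eq_zero.1 key with h3 | h3
  · rcases mul_eq_zero.1 h3 with h4 | h4
    · apply hac
      simp [h4]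
    · apply hbc
      obtain rfl : l = 1 := by linarith
      ext <;> simp
  · apply hab
    have h5 : (b1 - a1) = 0 := by nlinarith [sq_nonneg (b1 - a1), sq_nonneg (b2 - a2)]
    have h6 : (b2 - a2) = 0 := by nlinarith [sq_nonneg (b1 - a1), sq_nonneg (b2 - a2)]
    ext <;> simp <;> linarith

/-- Of the two ways of reconnecting four points on a circle, one is free of intersections. -/
lemma disjoint_chords {x : ℝ × ℝ} {r : ℝ} {a b c d : ℝ × ℝ} (ha : discFun x r a = 0)
    (hb : discFun x r b = 0) (hc : discFun x r c = 0) (hd : discFun x r d = 0)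
    (hab : a ≠ b) (hac : a ≠ c) (had : a ≠ d) (hbc : b ≠ c) (hbd : b ≠ d) :
    Disjoint (segment ℝ a b) (segment ℝ c d) ∨ Disjoint (segment ℝ c b) (segment ℝ a d) := by
  by_contra! hcon
  rw [not_disjoint_iff, not_disjoint_iff] at hcon
  obtain ⟨⟨p, hp1, hp2⟩, q, hq1, hq2⟩ := hcon
  have hLc := signedArea_ne_zero ha hb hc hab hac hbc
  have hLd := signedArea_ne_zero ha hb hd hab had hbd
  obtain ⟨s, s', hs, hs', hss, rfl⟩ := hp1
  obtain ⟨t, t', ht, ht', htt, hp⟩ := hp2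
  obtain ⟨m, m', hm, hm', hmm, rfl⟩ := hq1
  obtain ⟨n, n', hn, hn', hnn, hq⟩ := hq2
  obtain ⟨a1, a2⟩ := a
  obtain ⟨b1, b2⟩ := b
  obtain ⟨c1, c2⟩ := c
  obtain ⟨d1, d2⟩ := d
  simp only [Prod.smul_mk, smul_eq_mul, Prod.mk_add_mk, Prod.mk.injEq] at hp hq
  set Lc := signedArea (a1, a2) (b1, b2) (c1, c2) with hc'
  set Ld := signedArea (a1, a2) (b1, b2) (d1, d2) with hd'
  simp only [signedArea] at hc' hd'
  have e1 : t * Lc + t' * Ld = 0 := by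
    rw [hc', hd']
    obtain ⟨h1, h2⟩ := hp
    obtain rfl : s' = 1 - s := by linarith
    obtain rfl : t' = 1 - t := by linarith
    linear_combination (b1 - a1) * h2 - (b2 - a2) * h1
  have e2 : m * Lc = n' * Ld := by
    rw [hc', hd']
    obtain ⟨h1, h2⟩ := hq
    obtain rfl : m' = 1 - m := by linarith
    obtain rfl : n' = 1 - n := by linarith
    linear_combination -(b1 - a1) * h2 + (b2 - a2) * h1
  have ht'0 : 0 < t' := by
    rcases ht'.eq_or_lt with h | h
    · rw [← h] at e1 htt
      have : t = 1 := by linarith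
      rw [this] at e1
      exact absurd (by linarith) hLc
    · exact h
  have ht0 : 0 < t := by
    rcases ht.eq_or_lt with h | h
    · rw [← h] at e1 htt
      have : t' = 1 := by linarith
      rw [this] at e1
      exact absurd (by linarith) hLd
    · exact h
  have hLd2 : 0 < Ld ^ 2 := by positivity
  have e3 : m * (t' * Ld ^ 2) + n' * t * Ld ^ 2 = 0 := by
    linear_combination m * Ld * e1 - t * Ld * e2
  have hm0 : m = 0 := by
    have h1 : 0 ≤ n' * t * Ld ^ 2 := by positivity
    have h2 : 0 ≤ m * (t' * Ld ^ 2) := by positivity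
    have h3 : m * (t' * Ld ^ 2) = 0 := by linarith
    rcases mul_eq_zero.1 h3 with h | h
    · exact h
    · have : 0 < t' * Ld ^ 2 := by positivity
      linarith
  have hn0 : n' = 0 := by
    rw [hm0] at e2
    rcases mul_eq_zero.1 (e2.symm.trans (zero_mul _)) with h | h
    · exact h
    · exact absurd h hLd
  apply hab
  rw [hm0, hn0] at hq
  have : m' = 1 := by linarith
  have h2 : n = 1 := by linarith
  rw [this, h2] at hq
  ext
  · simpa using hq.1
  · simpa using hq.2

lemma convex_disc (x : ℝ × ℝ) (r : ℝ) : Convex ℝ {y | discFun x r y ≤ 0} := by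
  intro p hp q hq s t hs ht hst
  simp only [discFun, mem_ofPred_eq] at *
  obtain rfl : t = 1 - s := by linarith
  simp only [Prod.fst_add, Prod.smul_fst, Prod.snd_add, Prod.smul_snd, smul_eq_mul]
  nlinarith [mul_nonneg hs ht, mul_nonneg (mul_nonneg hs ht) (sq_nonneg (p.1 - q.1)),
    mul_nonneg (mul_nonneg hs ht) (sq_nonneg (p.2 - q.2)), mul_nonneg hs (neg_nonneg.2 hp),
    mul_nonneg ht (neg_nonneg.2 hq)]

/-- A small closed disc around a point avoids a given closed set not containing the point. -/
lemma exists_disc_disjoint {Z : Set (ℝ × ℝ)} (hZ : IsClosed Z) {x : ℝ × ℝ} (hx : x ∉ Z) :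
    ∃ r : ℝ, 0 < r ∧ Disjoint Z {y | discFun x r y ≤ 0} := by
  obtain ⟨ε, hε, hsub⟩ := Metric.isOpen_iff.1 hZ.isOpen_compl x hx
  refine ⟨ε / 2, by positivity, disjoint_left.2 fun y hy hy' => hsub ?_ hy⟩
  simp only [discFun, mem_ofPred_eq] at hy'
  have h1 : |y.1 - x.1| ≤ ε / 2 := abs_le_of_sq_le_sq (by nlinarith [sq_nonneg (y.2 - x.2)])
    (by positivity)
  have h2 : |y.2 - x.2| ≤ ε / 2 := abs_le_of_sq_le_sq (by nlinarith [sq_nonneg (y.1 - x.1)])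
    (by positivity)
  rw [Metric.mem_ball, Prod.dist_eq, Real.dist_eq, Real.dist_eq, max_lt_iff]
  constructor <;> linarith

lemma IsArc.reconnect {P Q B : Set (ℝ × ℝ)} {u a b v : ℝ × ℝ} (hB : Convex ℝ B)
    (hP : IsArc P u a) (hQ : IsArc Q v b) (hPB : P ∩ B = {a}) (hQB : Q ∩ B = {b})
    (hPQ : Disjoint P Q) : IsArc (P ∪ segment ℝ a b ∪ Q) u v := by
  have ha : a ∈ B := (hPB.symm.subset rfl).2
  have hb : b ∈ B := (hQB.symm.subset rfl).2
  have hab : a ≠ b := by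
    rintro rfl
    exact disjoint_left.1 hPQ hP.right_mem hQ.right_mem
  exact hP.concat₃ (IsArc.of_segment hab) hQ.symm (hB.segment_subset ha hb) hPB hQB hPQ

lemma inter_reconnect_subset {P₁ P₂ P₃ P₄ B : Set (ℝ × ℝ)} {a b c d : ℝ × ℝ} (hB : Convex ℝ B)
    (h₁ : P₁ ∩ B = {a}) (h₂ : P₂ ∩ B = {b}) (h₃ : P₃ ∩ B = {c}) (h₄ : P₄ ∩ B = {d})
    (hd : Disjoint (segment ℝ a b) (segment ℝ c d)) :
    (P₁ ∪ segment ℝ a b ∪ P₂) ∩ (P₃ ∪ segment ℝ c d ∪ P₄) ⊆ (P₁ ∪ P₂) ∩ (P₃ ∪ P₄) := by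
  have hab : segment ℝ a b ⊆ B :=
    hB.segment_subset (h₁.symm.subset rfl).2 (h₂.symm.subset rfl).2
  have hcd : segment ℝ c d ⊆ B :=
    hB.segment_subset (h₃.symm.subset rfl).2 (h₄.symm.subset rfl).2
  have key : ∀ {P : Set (ℝ × ℝ)} {a y : ℝ × ℝ}, P ∩ B = {a} → y ∈ P → y ∈ B → y = a :=
    fun h hy hyB => h.subset ⟨hy, hyB⟩
  rintro y ⟨(h | h) | h, (h' | h') | h'⟩
  · exact ⟨Or.inl h, Or.inl h'⟩
  · rw [key h₁ h (hcd h')] at h'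
    exact absurd h' (disjoint_left.1 hd (left_mem_segment ℝ a b))
  · exact ⟨Or.inl h, Or.inr h'⟩
  · rw [key h₃ h' (hab h)] at h
    exact absurd (left_mem_segment ℝ c d) (disjoint_left.1 hd h)
  · exact absurd h' (disjoint_left.1 hd h)
  · rw [key h₄ h' (hab h)] at h
    exact absurd (right_mem_segment ℝ c d) (disjoint_left.1 hd h)
  · exact ⟨Or.inr h, Or.inl h'⟩
  · rw [key h₂ h (hcd h')] at h'
    exact absurd h' (disjoint_left.1 hd (right_mem_segment ℝ a b))
  · exact ⟨Or.inr h, Or.inr h'⟩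

/-- Uncrossing two arcs with a common end at a common point `x` which is the first one on both. -/
lemma exists_uncrossing_same {Se Sf Z e₁ e₂ f₁ f₂ : Set (ℝ × ℝ)} {u v w x : ℝ × ℝ}
    (hfin : (Se ∩ Sf).Finite) (hv : v ∉ Sf) (hw : w ∉ Se) (hZ : IsClosed Z)
    (hZx : x ∉ Z) (hxu : x ≠ u) (hx : x ∈ Se ∩ Sf)
    (he₁ : IsArc e₁ u x) (he₂ : IsArc e₂ x v) (he : e₁ ∪ e₂ = Se) (he' : e₁ ∩ e₂ = {x})
    (hf₁ : IsArc f₁ u x) (hf₂ : IsArc f₂ x w) (hf : f₁ ∪ f₂ = Sf) (hf' : f₁ ∩ f₂ = {x})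
    (hef : ∀ y ∈ e₁, y ∈ Sf → y ≠ u → y = x) (hfe : ∀ y ∈ f₁, y ∈ Se → y ≠ u → y = x) :
    ∃ e' f', IsArc e' u v ∧ IsArc f' u w ∧ (e' ∪ f') ∩ Z ⊆ Se ∪ Sf ∧
      e' ∩ f' ⊆ (Se ∩ Sf) \ {x} := by
  have hxv : x ≠ v := fun h => hv (h ▸ hx.2)
  have hxw : x ≠ w := fun h => hw (h ▸ hx.1)
  have hfc : IsClosed ({u, v, w} ∪ ((Se ∩ Sf) \ {x})) :=
    ((toFinite _).union hfin.sdiff).isClosed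
  obtain ⟨r, hr, hdisj⟩ := exists_disc_disjoint (hZ.union hfc) (x := x) (by
    simp [hZx, hxu, hxv, hxw])
  set B := {y | discFun x r y ≤ 0} with hBdef
  have hBZ : ∀ y ∈ B, y ∉ Z := fun y hy h => disjoint_left.1 hdisj (Or.inl h) hy
  have hBu : ∀ y ∈ ({u, v, w} : Set (ℝ × ℝ)), y ∉ B :=
    fun y hy h => disjoint_left.1 hdisj (Or.inr (Or.inl hy)) h
  have hBx : ∀ y ∈ B, y ∈ Se → y ∈ Sf → y = x := by
    intro y hy h1 h2
    by_contra h
    exact disjoint_left.1 hdisj (Or.inr (Or.inr ⟨⟨h1, h2⟩, h⟩)) hy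
  have hBc : Convex ℝ B := convex_disc x r
  have hpos : ∀ y ∈ ({u, v, w} : Set (ℝ × ℝ)), 0 < discFun x r y :=
    fun y hy => not_le.1 (hBu y hy)
  have hx0 : discFun x r x < 0 := by simp [discFun]; positivity
  have hxB : x ∈ B := hx0.le
  have hg := continuous_discFun x r
  obtain ⟨a, ha, P₁, hP₁, hP₁a, hP₁B⟩ :=
    he₁.exists_boundary_hit hg (hpos u (by simp)) hx0.le
  obtain ⟨b, hb, P₂, hP₂, hP₂a, hP₂B⟩ :=
    he₂.symm.exists_boundary_hit hg (hpos v (by simp)) hx0.le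
  obtain ⟨c, hc, P₃, hP₃, hP₃a, hP₃B⟩ :=
    hf₁.exists_boundary_hit hg (hpos u (by simp)) hx0.le
  obtain ⟨d, hd, P₄, hP₄, hP₄a, hP₄B⟩ :=
    hf₂.symm.exists_boundary_hit hg (hpos w (by simp)) hx0.le
  rw [← hBdef] at hP₁B hP₂B hP₃B hP₄B
  have hne : ∀ y, discFun x r y = 0 → y ≠ x := by
    rintro y hy rfl
    exact hx0.ne hy
  have hxP : ∀ {P : Set (ℝ × ℝ)} {p : ℝ × ℝ}, P ∩ B = {p} → discFun x r p = 0 → x ∉ P :=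
    fun h hp hxP => hne _ hp (h.subset ⟨hxP, hxB⟩ : x = _).symm
  have hx₁ := hxP hP₁B ha
  have hx₂ := hxP hP₂B hb
  have hx₃ := hxP hP₃B hc
  have hx₄ := hxP hP₄B hd
  have he₁S : e₁ ⊆ Se := he ▸ subset_union_left
  have he₂S : e₂ ⊆ Se := he ▸ subset_union_right
  have hf₁S : f₁ ⊆ Sf := hf ▸ subset_union_left
  have hf₂S : f₂ ⊆ Sf := hf ▸ subset_union_right
  have ha' := hP₁a.right_mem
  have hb' := hP₂a.right_mem
  have hc' := hP₃a.right_mem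
  have hd' := hP₄a.right_mem
  have d12 : Disjoint P₁ P₂ := disjoint_left.2 fun y h1 h2 =>
    hx₁ ((he'.subset ⟨hP₁ h1, hP₂ h2⟩ : y = x) ▸ h1)
  have d34 : Disjoint P₃ P₄ := disjoint_left.2 fun y h1 h2 =>
    hx₃ ((hf'.subset ⟨hP₃ h1, hP₄ h2⟩ : y = x) ▸ h1)
  have hue₂ : u ∉ e₂ := fun h => hxu (he'.subset ⟨he₁.left_mem, h⟩ : u = x).symm
  have huf₂ : u ∉ f₂ := fun h => hxu (hf'.subset ⟨hf₁.left_mem, h⟩ : u = x).symm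
  have d14 : Disjoint P₁ P₄ := disjoint_left.2 fun y h1 h2 =>
    hx₁ (hef y (hP₁ h1) (hf₂S (hP₄ h2)) (fun h => huf₂ (h ▸ hP₄ h2)) ▸ h1)
  have d32 : Disjoint P₃ P₂ := disjoint_left.2 fun y h1 h2 =>
    hx₃ (hfe y (hP₃ h1) (he₂S (hP₂ h2)) (fun h => hue₂ (h ▸ hP₂ h2)) ▸ h1)
  have hBseg : ∀ {p q}, discFun x r p = 0 → discFun x r q = 0 → segment ℝ p q ⊆ B :=
    fun hp hq => hBc.segment_subset hp.le hq.le
  have hab : a ≠ b := fun h => disjoint_left.1 d12 ha' (h ▸ hb')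
  have had : a ≠ d := fun h => disjoint_left.1 d14 ha' (h ▸ hd')
  have hbc : b ≠ c := fun h => disjoint_left.1 d32 hc' (h ▸ hb')
  have hac : a ≠ c := fun h => hne a ha
    (hBx a ha.le (he₁S (hP₁ ha')) (hf₁S (hP₃ (h ▸ hc'))))
  have hbd : b ≠ d := fun h => hne b hb
    (hBx b hb.le (he₂S (hP₂ hb')) (hf₂S (hP₄ (h ▸ hd'))))
  rcases disjoint_chords ha hb hc hd hab hac had hbc hbd with hdc | hdc
  · refine ⟨_, _, hP₁a.reconnect hBc hP₂a hP₁B hP₂B d12,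
      hP₃a.reconnect hBc hP₄a hP₃B hP₄B d34, ?_,
      (inter_reconnect_subset hBc hP₁B hP₂B hP₃B hP₄B hdc).trans ?_⟩
    · rintro y ⟨((h | h) | h) | ((h | h) | h), hyZ⟩
      · exact Or.inl (he₁S (hP₁ h))
      · exact absurd hyZ (hBZ y (hBseg ha hb h))
      · exact Or.inl (he₂S (hP₂ h))
      · exact Or.inr (hf₁S (hP₃ h))
      · exact absurd hyZ (hBZ y (hBseg hc hd h))
      · exact Or.inr (hf₂S (hP₄ h))
    · rintro y ⟨h, h'⟩
      refine ⟨⟨h.elim (fun h => he₁S (hP₁ h)) fun h => he₂S (hP₂ h),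
        h'.elim (fun h => hf₁S (hP₃ h)) fun h => hf₂S (hP₄ h)⟩, ?_⟩
      rintro rfl
      exact h.elim hx₁ hx₂
  · refine ⟨_, _, hP₃a.reconnect hBc hP₂a hP₃B hP₂B d32,
      hP₁a.reconnect hBc hP₄a hP₁B hP₄B d14, ?_,
      (inter_reconnect_subset hBc hP₃B hP₂B hP₁B hP₄B hdc).trans ?_⟩
    · rintro y ⟨((h | h) | h) | ((h | h) | h), hyZ⟩
      · exact Or.inr (hf₁S (hP₃ h))
      · exact absurd hyZ (hBZ y (hBseg hc hb h))
      · exact Or.inl (he₂S (hP₂ h))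
      · exact Or.inl (he₁S (hP₁ h))
      · exact absurd hyZ (hBZ y (hBseg ha hd h))
      · exact Or.inr (hf₂S (hP₄ h))
    · rintro y ⟨h | h, h' | h'⟩
      · refine ⟨⟨he₁S (hP₁ h'), hf₁S (hP₃ h)⟩, ?_⟩
        rintro rfl
        exact hx₃ h
      · exact absurd h' (disjoint_left.1 d34 h)
      · exact absurd h (disjoint_left.1 d12 h')
      · refine ⟨⟨he₂S (hP₂ h), hf₂S (hP₄ h')⟩, ?_⟩
        rintro rfl
        exact hx₂ h

/-- Two arcs with a common end can be redrawn so that one of their other common points is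
removed, without leaving the union of the arcs except near this point. -/
lemma exists_uncrossing {Se Sf Z : Set (ℝ × ℝ)} {u v w : ℝ × ℝ} (hSe : IsArc Se u v)
    (hSf : IsArc Sf u w) (hv : v ∉ Sf) (hw : w ∉ Se) (hfin : (Se ∩ Sf).Finite)
    (hne : ((Se ∩ Sf) \ {u}).Nonempty) (hZ : IsClosed Z) (hZF : Disjoint Z ((Se ∩ Sf) \ {u})) :
    ∃ x ∈ (Se ∩ Sf) \ {u}, ∃ e' f', IsArc e' u v ∧ IsArc f' u w ∧ (e' ∪ f') ∩ Z ⊆ Se ∪ Sf ∧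
      e' ∩ f' ⊆ (Se ∩ Sf) \ {x} := by
  set F := (Se ∩ Sf) \ {u} with hF
  have hFc : IsClosed F := hfin.sdiff.isClosed
  obtain ⟨y, hy⟩ := hne
  obtain ⟨x, hx, e₁, he₁S, he₁, he₁F, he₂⟩ :=
    hSe.first_hit hFc (fun h => h.2 rfl) ⟨y, hy.1.1, hy⟩
  obtain ⟨z, hz, f₁, hf₁S, hf₁, hf₁F, hf₂⟩ :=
    hSf.first_hit hFc (fun h => h.2 rfl) ⟨y, hy.1.2, hy⟩
  obtain ⟨e₂, he₂, he, he'⟩ := he₂ (fun h => hv (h ▸ hx.1.2))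
  obtain ⟨f₂, hf₂, hf, hf'⟩ := hf₂ (fun h => hw (h ▸ hz.1.1))
  have he₂S : e₂ ⊆ Se := he ▸ subset_union_right
  have hf₂S : f₂ ⊆ Sf := hf ▸ subset_union_right
  have hef : ∀ y ∈ e₁, y ∈ Sf → y ≠ u → y = x := fun y h h' hu =>
    he₁F.subset ⟨h, ⟨he₁S h, h'⟩, hu⟩
  have hfe : ∀ y ∈ f₁, y ∈ Se → y ≠ u → y = z := fun y h h' hu =>
    hf₁F.subset ⟨h, ⟨h', hf₁S h⟩, hu⟩
  by_cases hxz : x = z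
  · subst hxz
    exact ⟨x, hx, exists_uncrossing_same hfin hv hw hZ (fun h => disjoint_left.1 hZF h hx)
      hx.2 hx.1 he₁ he₂ he he' hf₁ hf₂ hf hf' hef hfe⟩
  have hze₂ : z ∈ e₂ := by
    rcases he.symm.subset hz.1.1 with h | h
    · exact absurd (hef z h hz.1.2 hz.2).symm hxz
    · exact h
  have hxf₂ : x ∈ f₂ := by
    rcases hf.symm.subset hx.1.2 with h | h
    · exact absurd (hfe x h hx.1.1 hx.2) hxz
    · exact h
  obtain ⟨e₃, e₄, he₃, he₄, hee, hee'⟩ :=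
    he₂.split hze₂ (Ne.symm hxz) (fun h => hv (h ▸ hz.1.2))
  obtain ⟨f₃, f₄, hf₃, hf₄, hff, hff'⟩ :=
    hf₂.split hxf₂ hxz (fun h => hw (h ▸ hx.1.1))
  have he₄S : e₄ ⊆ e₂ := hee ▸ subset_union_right
  have hf₄S : f₄ ⊆ f₂ := hff ▸ subset_union_right
  have hue₂ : u ∉ e₂ := fun h => hx.2 (he'.subset ⟨he₁.left_mem, h⟩ : u = x).symm
  have huf₂ : u ∉ f₂ := fun h => hz.2 (hf'.subset ⟨hf₁.left_mem, h⟩ : u = z).symm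
  have hxe₄ : x ∉ e₄ := fun h => hxz (hee'.subset ⟨he₃.left_mem, h⟩)
  refine ⟨x, hx, f₁ ∪ e₄, e₁ ∪ f₄, hf₁.concat he₄ ?_, he₁.concat hf₄ ?_, ?_, ?_⟩
  · refine Subset.antisymm ?_ (singleton_subset_iff.2 ⟨hf₁.right_mem, he₄.left_mem⟩)
    rintro y ⟨h, h'⟩
    exact hfe y h (he₂S (he₄S h')) fun hu => hue₂ (hu ▸ he₄S h')
  · refine Subset.antisymm ?_ (singleton_subset_iff.2 ⟨he₁.right_mem, hf₄.left_mem⟩)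
    rintro y ⟨h, h'⟩
    exact hef y h (hf₂S (hf₄S h')) fun hu => huf₂ (hu ▸ hf₄S h')
  · rintro y ⟨(h | h) | (h | h), -⟩
    · exact Or.inr (hf₁S h)
    · exact Or.inl (he₂S (he₄S h))
    · exact Or.inl (he₁S h)
    · exact Or.inr (hf₂S (hf₄S h))
  · rintro y ⟨h | h, h' | h'⟩
    · refine ⟨⟨he₁S h', hf₁S h⟩, ?_⟩
      rintro rfl
      exact hxz (hfe y h (he₁S h') hx.2)
    · have : y = z := hf'.subset ⟨h, hf₄S h'⟩
      subst this
      exact ⟨hz.1, fun h => hxz (h : y = x).symm⟩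
    · have : y = x := he'.subset ⟨h', he₄S h⟩
      exact absurd (this ▸ h) hxe₄
    · refine ⟨⟨he₂S (he₄S h), hf₂S (hf₄S h')⟩, ?_⟩
      rintro rfl
      exact hxe₄ h

namespace PlaneDrawing

section Traces

variable {V : Type*} {G : SimpleGraph V} (D : PlaneDrawing G)

/-- The point set of an edge. -/
def trace (e : Sym2 V) : Set (ℝ × ℝ) :=
  {p | ∃ (u v : V) (h : G.Adj u v) (t : I), s(u, v) = e ∧ D.arc h t = p}

lemma trace_eq_range {u v : V} (h : G.Adj u v) : D.trace s(u, v) = range (D.arc h) := by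
  ext p
  constructor
  · rintro ⟨x, y, h', t, hxy, rfl⟩
    rcases Sym2.eq_iff.1 hxy with ⟨rfl, rfl⟩ | ⟨rfl, rfl⟩
    · exact ⟨t, rfl⟩
    · refine ⟨unitInterval.symm t, ?_⟩
      rw [D.arc_symm h']
      simp
  · rintro ⟨t, rfl⟩
    exact ⟨u, v, h, t, rfl, rfl⟩

lemma isArc_trace {u v : V} (h : G.Adj u v) : IsArc (D.trace s(u, v)) (D.pos u) (D.pos v) :=
  ⟨D.arc h, D.arc_inj h, (D.trace_eq_range h).symm⟩

lemma isClosed_trace {e : Sym2 V} (he : e ∈ G.edgeSet) : IsClosed (D.trace e) := by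
  induction e with
  | h u v => exact (D.isArc_trace he).isCompact.isClosed

lemma mem_of_pos_mem_trace {e : Sym2 V} {w : V} (h : D.pos w ∈ D.trace e) : w ∈ e := by
  obtain ⟨x, y, h', t, rfl, ht⟩ := h
  rcases D.no_vertex_mem h' w t ht with rfl | rfl <;> simp

lemma finite_trace_inter {e f : Sym2 V} (he : e ∈ G.edgeSet) (hf : f ∈ G.edgeSet) (hef : e ≠ f) :
    (D.trace e ∩ D.trace f).Finite := by
  induction e with
  | h u v =>
    induction f with
    | h x y =>
      rw [D.trace_eq_range he, D.trace_eq_range hf]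
      exact D.finite_inter he hf hef

lemma isInteriorPoint_iff {u v : V} (h : G.Adj u v) {p : ℝ × ℝ} :
    D.IsInteriorPoint h p ↔ p ∈ D.trace s(u, v) ∧ p ∉ range D.pos := by
  rw [D.trace_eq_range h]
  constructor
  · rintro ⟨t, h0, h1, rfl⟩
    refine ⟨⟨t, rfl⟩, ?_⟩
    rintro ⟨w, hw⟩
    rcases D.no_vertex_mem h w t hw.symm with rfl | rfl
    · exact h0 (D.arc_inj h (hw.symm.trans (D.arc h).source.symm))
    · exact h1 (D.arc_inj h (hw.symm.trans (D.arc h).target.symm))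
  · rintro ⟨⟨t, rfl⟩, h⟩
    refine ⟨t, ?_, ?_, rfl⟩
    · rintro rfl
      exact h ⟨u, by simp⟩
    · rintro rfl
      exact h ⟨v, by simp⟩

lemma mem_range_pos_of_mem_trace₃ {e f g : Sym2 V} (he : e ∈ G.edgeSet) (hf : f ∈ G.edgeSet)
    (hg : g ∈ G.edgeSet) (hef : e ≠ f) (heg : e ≠ g) (hfg : f ≠ g) {p : ℝ × ℝ}
    (hpe : p ∈ D.trace e) (hpf : p ∈ D.trace f) (hpg : p ∈ D.trace g) : p ∈ range D.pos := by
  by_contra hp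
  induction e with
  | h u v =>
    induction f with
    | h x y =>
      induction g with
      | h z w =>
        obtain ⟨t₁, h1, h1', hp1⟩ := (D.isInteriorPoint_iff he).2 ⟨hpe, hp⟩
        obtain ⟨t₂, h2, h2', hp2⟩ := (D.isInteriorPoint_iff hf).2 ⟨hpf, hp⟩
        obtain ⟨t₃, h3, h3', hp3⟩ := (D.isInteriorPoint_iff hg).2 ⟨hpg, hp⟩
        exact D.no_triple_point he hf hg hef heg hfg t₁ t₂ t₃ h1 h1' h2 h2' h3 h3'
          (hp1.trans hp2.symm) (hp2.trans hp3.symm)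

lemma mem_crossings_iff {p : ℝ × ℝ} : p ∈ D.crossings ↔ p ∉ range D.pos ∧
    ∃ e ∈ G.edgeSet, ∃ f ∈ G.edgeSet, e ≠ f ∧ p ∈ D.trace e ∧ p ∈ D.trace f := by
  constructor
  · rintro ⟨u, v, x, y, h₁, h₂, hne, hp₁, hp₂⟩
    rw [isInteriorPoint_iff] at hp₁ hp₂
    exact ⟨hp₁.2, _, h₁, _, h₂, hne, hp₁.1, hp₂.1⟩
  · rintro ⟨hp, e, he, f, hf, hne, hpe, hpf⟩
    induction e with
    | h u v =>
      induction f with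
      | h x y =>
        exact ⟨u, v, x, y, he, hf, hne, (D.isInteriorPoint_iff he).2 ⟨hpe, hp⟩,
          (D.isInteriorPoint_iff hf).2 ⟨hpf, hp⟩⟩

lemma edgeCrossings_eq {u v : V} (h : G.Adj u v) :
    D.edgeCrossings h = D.crossings ∩ D.trace s(u, v) := by
  ext p
  constructor
  · rintro ⟨hp, x, y, h₂, hne, hp₂⟩
    exact ⟨⟨u, v, x, y, h, h₂, hne, hp, hp₂⟩, ((D.isInteriorPoint_iff h).1 hp).1⟩
  · rintro ⟨hp, hpt⟩
    obtain ⟨hp, e, he, f, hf, hne, hpe, hpf⟩ := D.mem_crossings_iff.1 hp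
    refine ⟨(D.isInteriorPoint_iff h).2 ⟨hpt, hp⟩, ?_⟩
    by_cases heq : s(u, v) = e
    · induction f with
      | h x y => exact ⟨x, y, hf, heq ▸ hne, (D.isInteriorPoint_iff hf).2 ⟨hpf, hp⟩⟩
    · induction e with
      | h x y => exact ⟨x, y, he, heq, (D.isInteriorPoint_iff he).2 ⟨hpe, hp⟩⟩

lemma isKPlane_iff {k : ℕ} :
    D.IsKPlane k ↔ ∀ e ∈ G.edgeSet, (D.crossings ∩ D.trace e).ncard ≤ k := by
  constructor
  · intro h e he
    induction e with
    | h u v => exact D.edgeCrossings_eq he ▸ h he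
  · intro h u v huv
    rw [edgeCrossings_eq]
    exact h _ huv

lemma finite_crossings [Finite V] : D.crossings.Finite := by
  have : D.crossings ⊆ ⋃ q ∈ {q : Sym2 V × Sym2 V | q.1 ∈ G.edgeSet ∧ q.2 ∈ G.edgeSet ∧
      q.1 ≠ q.2}, D.trace q.1 ∩ D.trace q.2 := by
    intro p hp
    obtain ⟨-, e, he, f, hf, hne, hpe, hpf⟩ := D.mem_crossings_iff.1 hp
    exact mem_biUnion (x := (e, f)) ⟨he, hf, hne⟩ ⟨hpe, hpf⟩
  exact ((toFinite _).biUnion fun q hq => D.finite_trace_inter hq.1 hq.2.1 hq.2.2).subset this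

end Traces

/-- A drawing is determined by the positions of the vertices and the point sets of the edges. -/
lemma exists_of_isArc {V : Type*} {G : SimpleGraph V} (pos : V → ℝ × ℝ)
    (hpos : Function.Injective pos) (A : Sym2 V → Set (ℝ × ℝ))
    (harc : ∀ u v, G.Adj u v → IsArc (A s(u, v)) (pos u) (pos v))
    (hmem : ∀ e ∈ G.edgeSet, ∀ w, pos w ∈ A e → w ∈ e)
    (hfin : ∀ e ∈ G.edgeSet, ∀ f ∈ G.edgeSet, e ≠ f → (A e ∩ A f).Finite)
    (htriple : ∀ e ∈ G.edgeSet, ∀ f ∈ G.edgeSet, ∀ g ∈ G.edgeSet, e ≠ f → e ≠ g → f ≠ g →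
      ∀ p ∈ A e, p ∈ A f → p ∈ A g → p ∈ range pos) :
    ∃ D : PlaneDrawing G, D.pos = pos ∧ ∀ e ∈ G.edgeSet, D.trace e = A e := by
  classical
  let _ : LinearOrder V := linearOrderOfSTO WellOrderingRel
  choose γ hγ hγr using harc
  let arc : ∀ ⦃u v : V⦄, G.Adj u v → Path (pos u) (pos v) := fun u v h =>
    if u < v then γ u v h else (γ v u h.symm).symm
  have harc_range : ∀ ⦃u v : V⦄ (h : G.Adj u v), range (arc h) = A s(u, v) := by
    intro u v h
    by_cases huv : u < v
    · simp only [arc, if_pos huv, hγr]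
    · simp only [arc, if_neg huv, Path.symm_range, hγr, Sym2.eq_swap]
  have harc_inj : ∀ ⦃u v : V⦄ (h : G.Adj u v), Function.Injective (arc h) := by
    intro u v h
    by_cases huv : u < v
    · simp only [arc, if_pos huv, hγ]
    · simp only [arc, if_neg huv]
      exact (hγ v u h.symm).comp unitInterval.symm_bijective.1
  have hmem' : ∀ ⦃u v : V⦄ (h : G.Adj u v) (w : V) (t : I), arc h t = pos w → w = u ∨ w = v := by
    intro u v h w t ht
    have := hmem s(u, v) h w (by rw [← harc_range h]; exact ⟨t, ht⟩)
    simpa using this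
  have hvertex : ∀ ⦃u v : V⦄ (h : G.Adj u v) (t : I), t ≠ 0 → t ≠ 1 → arc h t ∉ range pos := by
    rintro u v h t h0 h1 ⟨w, hw⟩
    rcases hmem' h w t hw.symm with rfl | rfl
    · exact h0 (harc_inj h (hw.symm.trans (arc h).source.symm))
    · exact h1 (harc_inj h (hw.symm.trans (arc h).target.symm))
  have hA : ∀ ⦃u v : V⦄ (h : G.Adj u v) (t : I), arc h t ∈ A s(u, v) := by
    intro u v h t
    rw [← harc_range h]
    exact ⟨t, rfl⟩
  let D : PlaneDrawing G :=
    { pos := pos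
      pos_inj := hpos
      arc := arc
      arc_symm := by
        intro u v h
        rcases lt_or_gt_of_ne h.ne with huv | huv
        · simp only [arc, if_pos huv, if_neg huv.not_gt]
        · simp only [arc, if_pos huv, if_neg huv.not_gt, Path.symm_symm]
      arc_inj := harc_inj
      no_vertex_mem := hmem'
      finite_inter := by
        intro u v x y h₁ h₂ hne
        rw [harc_range, harc_range]
        exact hfin _ h₁ _ h₂ hne
      no_triple_point := by
        intro u₁ v₁ u₂ v₂ u₃ v₃ h₁ h₂ h₃ h12 h13 h23 t₁ t₂ t₃ h h' _ _ _ _ e1 e2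
        refine hvertex h₁ t₁ h h' (htriple _ h₁ _ h₂ _ h₃ h12 h13 h23 _ (hA h₁ t₁) ?_ ?_)
        · rw [e1]
          exact hA h₂ t₂
        · rw [e1, e2]
          exact hA h₃ t₃ }
  refine ⟨D, rfl, fun e he => ?_⟩
  induction e with
  | h u v => exact (D.trace_eq_range he).trans (harc_range he)

/-- Crossing adjacent edges of a 2-plane drawing can be redrawn with fewer crossings. -/
lemma exists_fewer_crossings {V : Type*} [Finite V] {G : SimpleGraph V} (D : PlaneDrawing G)
    (hD : D.IsKPlane 2) {u v w : V} (huv : G.Adj u v) (huw : G.Adj u w) (hvw : v ≠ w)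
    (hne : ((D.trace s(u, v) ∩ D.trace s(u, w)) \ {D.pos u}).Nonempty) :
    ∃ D' : PlaneDrawing G, D'.IsKPlane 2 ∧ D'.crossingCount < D.crossingCount := by
  classical
  set e := s(u, v) with he
  set f := s(u, w) with hf
  have heG : e ∈ G.edgeSet := huv
  have hfG : f ∈ G.edgeSet := huw
  have hef : e ≠ f := by
    intro h
    rcases Sym2.eq_iff.1 h with ⟨-, h⟩ | ⟨h, -⟩
    · exact hvw h
    · exact huw.ne h
  have hve : v ∉ f := by simp [hf, huv.ne', hvw]
  have hwe : w ∉ e := by simp [he, huw.ne', hvw.symm]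
  have hcommon : ∀ z, z ∈ e → z ∈ f → z = u := by
    intro z h h'
    rcases Sym2.mem_iff.1 h with rfl | rfl
    · rfl
    · exact absurd h' hve
  set Z : Set (ℝ × ℝ) := range D.pos ∪ ⋃ g ∈ {g | g ∈ G.edgeSet ∧ g ≠ e ∧ g ≠ f}, D.trace g
    with hZ
  have hZc : IsClosed Z :=
    (finite_range _).isClosed.union
      ((toFinite _).isClosed_biUnion fun g hg => D.isClosed_trace hg.1)
  have hposZ : ∀ z, D.pos z ∈ Z := fun z => Or.inl ⟨z, rfl⟩
  have htrZ : ∀ g ∈ G.edgeSet, g ≠ e → g ≠ f → D.trace g ⊆ Z := fun g hg h h' p hp =>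
    Or.inr (mem_biUnion (x := g) ⟨hg, h, h'⟩ hp)
  have hZF : Disjoint Z ((D.trace e ∩ D.trace f) \ {D.pos u}) := by
    rw [disjoint_left]
    rintro p hp ⟨⟨hpe, hpf⟩, hpu⟩
    have : p ∈ range D.pos := by
      rcases hp with hp | hp
      · exact hp
      · obtain ⟨g, ⟨hg, hge, hgf⟩, hpg⟩ := mem_iUnion₂.1 hp
        exact D.mem_range_pos_of_mem_trace₃ heG hfG hg hef hge.symm hgf.symm hpe hpf hpg
    obtain ⟨z, rfl⟩ := this
    exact hpu (congrArg D.pos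
      (hcommon z (D.mem_of_pos_mem_trace hpe) (D.mem_of_pos_mem_trace hpf)))
  obtain ⟨x, hx, e', f', he', hf', hsub, hinter⟩ :=
    exists_uncrossing (D.isArc_trace huv) (D.isArc_trace huw)
      (fun h => hve (D.mem_of_pos_mem_trace h)) (fun h => hwe (D.mem_of_pos_mem_trace h))
      (D.finite_trace_inter heG hfG hef) hne hZc hZF
  have hxZ : x ∉ Z := fun h => disjoint_left.1 hZF h hx
  let A : Sym2 V → Set (ℝ × ℝ) := fun g => if g = e then e' else if g = f then f' else D.trace g
  have hAe : A e = e' := if_pos rfl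
  have hAf : A f = f' := by simp only [A, if_neg hef.symm, if_true]
  have hAg : ∀ g, g ≠ e → g ≠ f → A g = D.trace g := fun g h h' => by
    simp only [A, if_neg h, if_neg h']
  have hAZ : ∀ p ∈ Z, p ∈ e' ∪ f' → p ∈ D.trace e ∪ D.trace f := fun p hp hp' => hsub ⟨hp', hp⟩
  have hperm : ∀ a ∈ G.edgeSet, ∀ b ∈ G.edgeSet, a ≠ b → ∀ p ∈ A a, p ∈ A b →
      p ≠ x ∧ ∃ π : Equiv.Perm (Sym2 V), (π = 1 ∨ π = Equiv.swap e f) ∧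
        ∀ g, p ∈ A g → p ∈ D.trace (π g) := by
    intro a ha b hb hab p hpa hpb
    by_cases hp : p ∈ e' ∩ f'
    · refine ⟨?_, 1, Or.inl rfl, fun g hg => ?_⟩
      · rintro rfl
        exact (hinter hp).2 rfl
      · by_cases hge : g = e
        · rw [hge]
          exact (hinter hp).1.1
        by_cases hgf : g = f
        · rw [hgf]
          exact (hinter hp).1.2
        rwa [hAg g hge hgf] at hg
    · have hpZ : p ∈ Z := by
        by_contra hpZ
        have key : ∀ g ∈ G.edgeSet, p ∈ A g → g = e ∨ g = f := by
          intro g hg hpg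
          by_contra! h
          rw [hAg g h.1 h.2] at hpg
          exact hpZ (htrZ g hg h.1 h.2 hpg)
        rcases key a ha hpa with rfl | rfl <;> rcases key b hb hpb with rfl | rfl
        · exact hab rfl
        · exact hp ⟨hAe ▸ hpa, hAf ▸ hpb⟩
        · exact hp ⟨hAe ▸ hpb, hAf ▸ hpa⟩
        · exact hab rfl
      refine ⟨fun h => hxZ (h ▸ hpZ), ?_⟩
      by_cases hid : (p ∈ e' → p ∈ D.trace e) ∧ (p ∈ f' → p ∈ D.trace f)
      · refine ⟨1, Or.inl rfl, fun g hg => ?_⟩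
        by_cases hge : g = e
        · rw [hge, hAe] at hg
          rw [hge]
          exact hid.1 hg
        by_cases hgf : g = f
        · rw [hgf, hAf] at hg
          rw [hgf]
          exact hid.2 hg
        rwa [hAg g hge hgf] at hg
      · refine ⟨Equiv.swap e f, Or.inr rfl, fun g hg => ?_⟩
        by_cases hge : g = e
        · rw [hge, hAe] at hg
          rw [hge, Equiv.swap_apply_left]
          have h1 := hAZ p hpZ (Or.inl hg)
          have h2 : p ∉ f' := fun h => hp ⟨hg, h⟩
          simp only [mem_union] at h1
          tauto
        by_cases hgf : g = f
        · rw [hgf, hAf] at hg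
          rw [hgf, Equiv.swap_apply_right]
          have h1 := hAZ p hpZ (Or.inr hg)
          have h2 : p ∉ e' := fun h => hp ⟨h, hg⟩
          simp only [mem_union] at h1
          tauto
        rw [hAg g hge hgf] at hg
        rwa [Equiv.swap_apply_of_ne_of_ne hge hgf]
  have hpermG : ∀ π : Equiv.Perm (Sym2 V), (π = 1 ∨ π = Equiv.swap e f) →
      ∀ g ∈ G.edgeSet, π g ∈ G.edgeSet := by
    rintro π (rfl | rfl) g hg
    · exact hg
    · by_cases hge : g = e
      · rwa [hge, Equiv.swap_apply_left]
      by_cases hgf : g = f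
      · rwa [hgf, Equiv.swap_apply_right]
      rwa [Equiv.swap_apply_of_ne_of_ne hge hgf]
  have huve : D.pos w ∉ e' := fun h => hwe (D.mem_of_pos_mem_trace (hinter ⟨h, hf'.right_mem⟩).1.1)
  have huwf : D.pos v ∉ f' := fun h => hve (D.mem_of_pos_mem_trace (hinter ⟨he'.right_mem, h⟩).1.2)
  have hzuvw : ∀ z, D.pos z ∈ e' ∪ f' → z = u ∨ z = v ∨ z = w := by
    intro z hz
    rcases hAZ _ (hposZ z) hz with h | h
    · have := D.mem_of_pos_mem_trace h
      simp only [he, Sym2.mem_iff] at this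
      tauto
    · have := D.mem_of_pos_mem_trace h
      simp only [hf, Sym2.mem_iff] at this
      tauto
  have hfin₁ : ∀ g ∈ G.edgeSet, g ≠ e → g ≠ f → ((e' ∪ f') ∩ D.trace g).Finite := by
    intro g hg hge hgf
    refine ((D.finite_trace_inter heG hg hge.symm).union
      (D.finite_trace_inter hfG hg hgf.symm)).subset ?_
    rintro p ⟨hp, hpg⟩
    rcases hAZ p (htrZ g hg hge hgf hpg) hp with h | h
    · exact Or.inl ⟨h, hpg⟩
    · exact Or.inr ⟨h, hpg⟩
  have hAsub : ∀ g, g = e ∨ g = f → A g ⊆ e' ∪ f' := by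
    rintro g (rfl | rfl)
    · rw [hAe]
      exact subset_union_left
    · rw [hAf]
      exact subset_union_right
  obtain ⟨D', hpos, htr⟩ := exists_of_isArc (G := G) D.pos D.pos_inj A (by
      intro a b hab
      by_cases hge : s(a, b) = e
      · rw [hge, hAe]
        rcases Sym2.eq_iff.1 hge with ⟨rfl, rfl⟩ | ⟨rfl, rfl⟩
        · exact he'
        · exact he'.symm
      by_cases hgf : s(a, b) = f
      · rw [hgf, hAf]
        rcases Sym2.eq_iff.1 hgf with ⟨rfl, rfl⟩ | ⟨rfl, rfl⟩
        · exact hf'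
        · exact hf'.symm
      rw [hAg _ hge hgf]
      exact D.isArc_trace hab) (by
      intro g hg z hz
      by_cases hge : g = e
      · rw [hge, hAe] at hz
        rcases hzuvw z (Or.inl hz) with rfl | rfl | rfl
        · simp [hge, he]
        · simp [hge, he]
        · exact absurd hz huve
      by_cases hgf : g = f
      · rw [hgf, hAf] at hz
        rcases hzuvw z (Or.inr hz) with rfl | rfl | rfl
        · simp [hgf, hf]
        · exact absurd hz huwf
        · simp [hgf, hf]
      rw [hAg g hge hgf] at hz
      exact D.mem_of_pos_mem_trace hz) (by
      intro a ha b hb hab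
      by_cases h1 : a = e ∨ a = f
      · by_cases h2 : b = e ∨ b = f
        · have hfin' : (e' ∩ f').Finite :=
            (D.finite_trace_inter heG hfG hef).subset fun p hp => (hinter hp).1
          rcases h1 with rfl | rfl <;> rcases h2 with rfl | rfl
          · exact absurd rfl hab
          · rwa [hAe, hAf]
          · rwa [hAe, hAf, inter_comm]
          · exact absurd rfl hab
        · push Not at h2
          rw [hAg b h2.1 h2.2]
          exact (hfin₁ b hb h2.1 h2.2).subset (inter_subset_inter_left _ (hAsub a h1))
      · push Not at h1
        rw [hAg a h1.1 h1.2, inter_comm]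
        by_cases h2 : b = e ∨ b = f
        · exact (hfin₁ a ha h1.1 h1.2).subset (inter_subset_inter_left _ (hAsub b h2))
        · push Not at h2
          rw [hAg b h2.1 h2.2]
          exact D.finite_trace_inter hb ha hab.symm) (by
      intro a ha b hb c hc hab hac hbc p hpa hpb hpc
      obtain ⟨-, π, hπ, h⟩ := hperm a ha b hb hab p hpa hpb
      exact D.mem_range_pos_of_mem_trace₃ (hpermG π hπ a ha) (hpermG π hπ b hb)
        (hpermG π hπ c hc) (π.injective.ne hab) (π.injective.ne hac) (π.injective.ne hbc)
        (h a hpa) (h b hpb) (h c hpc))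
  have hcross : ∀ p ∈ D'.crossings, p ∈ D.crossings \ {x} ∧
      ∃ π : Equiv.Perm (Sym2 V), (π = 1 ∨ π = Equiv.swap e f) ∧
        ∀ g ∈ G.edgeSet, p ∈ D'.trace g → p ∈ D.trace (π g) := by
    intro p hp
    obtain ⟨hpp, a, ha, b, hb, hab, hpa, hpb⟩ := D'.mem_crossings_iff.1 hp
    rw [htr a ha] at hpa
    rw [htr b hb] at hpb
    obtain ⟨hpx, π, hπ, h⟩ := hperm a ha b hb hab p hpa hpb
    refine ⟨⟨D.mem_crossings_iff.2 ⟨hpos ▸ hpp, π a, hpermG π hπ a ha, π b, hpermG π hπ b hb,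
      π.injective.ne hab, h a hpa, h b hpb⟩, hpx⟩, π, hπ, fun g hg hpg => h g (htr g hg ▸ hpg)⟩
  have hxc : x ∈ D.crossings :=
    D.mem_crossings_iff.2 ⟨fun h => hxZ (Or.inl h), e, heG, f, hfG, hef, hx.1.1, hx.1.2⟩
  have hcf := D.finite_crossings
  rw [isKPlane_iff] at hD
  refine ⟨D', D'.isKPlane_iff.2 fun g hg => ?_, ?_⟩
  · by_cases hgef : g = e ∨ g = f
    · have hsub' : D'.crossings ∩ D'.trace g ⊆
          ((D.crossings ∩ D.trace e) \ {x}) ∪ ((D.crossings ∩ D.trace f) \ {x}) := by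
        rintro p ⟨hp, hpg⟩
        obtain ⟨hpc, π, hπ, h⟩ := hcross p hp
        have h1 := h g hg hpg
        have h2 : π g = e ∨ π g = f := by
          rcases hπ with rfl | rfl <;> rcases hgef with rfl | rfl <;> simp
        rcases h2 with h2 | h2
        · rw [h2] at h1
          exact Or.inl ⟨⟨hpc.1, h1⟩, hpc.2⟩
        · rw [h2] at h1
          exact Or.inr ⟨⟨hpc.1, h1⟩, hpc.2⟩
      have h1 := ncard_sdiff_singleton_of_mem (s := D.crossings ∩ D.trace e) ⟨hxc, hx.1.1⟩
      have h2 := ncard_sdiff_singleton_of_mem (s := D.crossings ∩ D.trace f) ⟨hxc, hx.1.2⟩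
      have h3 := ncard_le_ncard hsub'
        ((hcf.inter_of_left _).sdiff.union (hcf.inter_of_left _).sdiff)
      have h4 := ncard_union_le ((D.crossings ∩ D.trace e) \ {x})
        ((D.crossings ∩ D.trace f) \ {x})
      have h5 := hD e heG
      have h6 := hD f hfG
      omega
    · push Not at hgef
      refine (ncard_le_ncard ?_ (hcf.inter_of_left _)).trans (hD g hg)
      rintro p ⟨hp, hpg⟩
      obtain ⟨hpc, -⟩ := hcross p hp
      rw [htr g hg, hAg g hgef.1 hgef.2] at hpg
      exact ⟨hpc.1, hpg⟩
  · refine ncard_lt_ncard ⟨fun p hp => (hcross p hp).1.1, fun h => ?_⟩ hcf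
    exact (hcross x (h hxc)).1.2 rfl

section Blocks

variable {V : Type*} {G : SimpleGraph V} (D : PlaneDrawing G)

lemma isPathConnected_trace_sdiff {e : Sym2 V} (he : e ∈ G.edgeSet) (R : Set V) :
    IsPathConnected (D.trace e \ D.pos '' R) := by
  induction e with
  | h u v =>
    rw [D.trace_eq_range he]
    set J : Set ℝ := {t | ∃ s : I, (s : ℝ) = t ∧ D.arc he s ∉ D.pos '' R} with hJ
    have hin : ∀ s : I, s ≠ 0 → s ≠ 1 → D.arc he s ∉ D.pos '' R := by
      rintro s h0 h1 ⟨w, -, hw⟩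
      exact ((D.isInteriorPoint_iff he).1 ⟨s, h0, h1, rfl⟩).2 ⟨w, hw⟩
    have hconn : J.OrdConnected := by
      refine ⟨fun a ha b hb c hc => ?_⟩
      rcases hc.1.eq_or_lt with rfl | h1
      · exact ha
      rcases hc.2.eq_or_lt with rfl | h2
      · exact hb
      obtain ⟨s, rfl, -⟩ := ha
      obtain ⟨t, rfl, -⟩ := hb
      have hc0 : 0 < c := s.2.1.trans_lt h1
      have hc1 : c < 1 := h2.trans_le t.2.2
      refine ⟨⟨c, hc0.le, hc1.le⟩, rfl, hin _ ?_ ?_⟩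
      · intro h
        exact hc0.ne' (congrArg Subtype.val h)
      · intro h
        exact hc1.ne (congrArg Subtype.val h)
    have hne : J.Nonempty := by
      refine ⟨1 / 2, ⟨1 / 2, by norm_num, by norm_num⟩, rfl, hin _ ?_ ?_⟩ <;>
      · intro h
        have := congrArg Subtype.val h
        norm_num at this
    have := (hconn.convex.isPathConnected hne).image (D.arc he).continuous_extend
    convert this using 1
    ext p
    constructor
    · rintro ⟨⟨s, rfl⟩, hs⟩
      exact ⟨s, ⟨s, rfl, hs⟩, by simp⟩
    · rintro ⟨_, ⟨s, rfl, hs⟩, rfl⟩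
      rw [Path.extend_extends']
      exact ⟨⟨s, rfl⟩, hs⟩

lemma exists_crossing_ends [Nonempty V] : ∃ ends : ℝ × ℝ → Sym2 (Sym2 V), ∀ p ∈ D.crossings,
    ∃ e ∈ G.edgeSet, ∃ f ∈ G.edgeSet, e ≠ f ∧ ends p = s(e, f) ∧
      p ∈ D.trace e ∧ p ∈ D.trace f := by
  have h : ∀ p, ∃ q : Sym2 (Sym2 V), p ∈ D.crossings → ∃ e ∈ G.edgeSet, ∃ f ∈ G.edgeSet, e ≠ f ∧
      q = s(e, f) ∧ p ∈ D.trace e ∧ p ∈ D.trace f := by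
    intro p
    by_cases hp : p ∈ D.crossings
    · obtain ⟨-, e, he, f, hf, hne, hpe, hpf⟩ := D.mem_crossings_iff.1 hp
      exact ⟨s(e, f), fun _ => ⟨e, he, f, hf, hne, rfl, hpe, hpf⟩⟩
    · obtain ⟨v⟩ := ‹Nonempty V›
      exact ⟨s(s(v, v), s(v, v)), fun h => absurd h hp⟩
  choose ends hends using h
  exact ⟨ends, hends⟩

/-- In a block of pairwise disjoint crossing edges, there are two more vertices than edges. -/
lemma card_add_two_le_of_isBlock [Fintype V] [DecidableEq V] {P : Type*}
    {ends : P → Sym2 (Sym2 V)} {X : Finset P} {b : Finset (Sym2 V)}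
    (hb : CrossingBlocks.IsBlock ends X b)
    (hdiag : ∀ p ∈ X, ∀ e ∈ ends p, ¬ e.IsDiag)
    (hdisj : ∀ p ∈ X, ∀ e f, ends p = s(e, f) → ∀ v ∈ e, v ∉ f) :
    b.card + 2 ≤ (Finset.univ.filter fun v : V => ∃ e ∈ b, v ∈ e).card := by
  have hfour : ∀ p ∈ X, ∀ e f, ends p = s(e, f) → (e.toFinset ∪ f.toFinset).card = 4 := by
    intro p hp e f hpe
    rw [Finset.card_union_of_disjoint, Sym2.card_toFinset_of_not_isDiag,
      Sym2.card_toFinset_of_not_isDiag]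
    · exact hdiag p hp f (by simp [hpe])
    · exact hdiag p hp e (by simp [hpe])
    · rw [Finset.disjoint_left]
      intro v hv hv'
      exact hdisj p hp e f hpe v (Sym2.mem_toFinset.1 hv) (Sym2.mem_toFinset.1 hv')
  rcases hb with ⟨e, f, p, hp, hef, hpe, rfl⟩ |
    ⟨e, f, g, p, hp, q, hq, hef, hfg, heg, hpe, hqe, rfl⟩
  · rw [Finset.card_pair hef]
    refine (hfour p hp e f hpe).symm.le.trans (Finset.card_le_card fun v hv => ?_)
    simpa using hv
  · obtain ⟨v, hve, hvg⟩ : ∃ v ∈ e, v ∉ g := by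
      by_contra! h
      induction e with
      | h x y =>
        have hxy : x ≠ y := hdiag p hp s(x, y) (by simp [hpe])
        exact heg (((Sym2.mem_and_mem_iff hxy).1 ⟨h x (by simp), h y (by simp)⟩).symm)
    have hvf := hdisj p hp e f hpe v hve
    have h5 : (insert v (f.toFinset ∪ g.toFinset)).card = 5 := by
      rw [Finset.card_insert_of_notMem (by simp [hvf, hvg]), hfour q hq f g hqe]
    have h3 : ({e, f, g} : Finset (Sym2 V)).card ≤ 3 := Finset.card_le_three
    have h6 : (insert v (f.toFinset ∪ g.toFinset)).card ≤
        (Finset.univ.filter fun v : V => ∃ a ∈ ({e, f, g} : Finset (Sym2 V)), v ∈ a).card := by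
      refine Finset.card_le_card fun w hw => ?_
      simp only [Finset.mem_insert, Finset.mem_union, Sym2.mem_toFinset] at hw
      simp only [Finset.mem_filter, Finset.mem_univ, true_and, Finset.mem_insert,
        Finset.mem_singleton, exists_eq_or_imp, exists_eq_left]
      rcases hw with rfl | hw | hw
      · exact Or.inl hve
      · exact Or.inr (Or.inl hw)
      · exact Or.inr (Or.inr hw)
    omega

/-- The part of the drawing occupied by a block of edges, with the vertices in `R` removed. -/
def blockRegion (b : Finset (Sym2 V)) (R : Set V) : Set (ℝ × ℝ) :=
  ⋃ e ∈ b, D.trace e \ D.pos '' R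

lemma mem_blockRegion {b : Finset (Sym2 V)} {R : Set V} {p : ℝ × ℝ} :
    p ∈ D.blockRegion b R ↔ (∃ e ∈ b, p ∈ D.trace e) ∧ p ∉ D.pos '' R := by
  simp only [blockRegion, mem_iUnion, mem_sdiff, exists_prop]
  exact ⟨fun ⟨e, he, h, h'⟩ => ⟨⟨e, he, h⟩, h'⟩, fun ⟨⟨e, he, h⟩, h'⟩ => ⟨e, he, h, h'⟩⟩

lemma isPathConnected_blockRegion [DecidableEq V] {ends : ℝ × ℝ → Sym2 (Sym2 V)}
    {X : Finset (ℝ × ℝ)} {b : Finset (Sym2 V)} (hb : CrossingBlocks.IsBlock ends X b)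
    (hX : ∀ p ∈ X, p ∉ range D.pos ∧ ∀ e ∈ ends p, e ∈ G.edgeSet ∧ p ∈ D.trace e) (R : Set V) :
    IsPathConnected (D.blockRegion b R) := by
  have hpair : ∀ p ∈ X, ∀ e f, ends p = s(e, f) →
      ((D.trace e \ D.pos '' R) ∩ (D.trace f \ D.pos '' R)).Nonempty ∧
        e ∈ G.edgeSet ∧ f ∈ G.edgeSet := by
    intro p hp e f hpe
    have h1 := (hX p hp).2 e (by simp [hpe])
    have h2 := (hX p hp).2 f (by simp [hpe])
    have h3 : p ∉ D.pos '' R := fun h => (hX p hp).1 (image_subset_range _ _ h)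
    exact ⟨⟨p, ⟨h1.2, h3⟩, h2.2, h3⟩, h1.1, h2.1⟩
  rcases hb with ⟨e, f, p, hp, hef, hpe, rfl⟩ |
    ⟨e, f, g, p, hp, q, hq, hef, hfg, heg, hpe, hqe, rfl⟩
  · obtain ⟨hne, he, hf⟩ := hpair p hp e f hpe
    have := (D.isPathConnected_trace_sdiff he R).union (D.isPathConnected_trace_sdiff hf R) hne
    convert this using 1
    simp [blockRegion]
  · obtain ⟨hne, he, hf⟩ := hpair p hp e f hpe
    obtain ⟨hne', -, hg⟩ := hpair q hq f g hqe
    have h1 := (D.isPathConnected_trace_sdiff hf R).union (D.isPathConnected_trace_sdiff hg R) hne'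
    have := (D.isPathConnected_trace_sdiff he R).union h1
      (hne.mono (inter_subset_inter_right _ subset_union_left))
    convert this using 1
    simp [blockRegion]

variable [Fintype V] [DecidableEq V]

/-- The incidences between vertices and blocks. -/
def blockIncidences (Bs : Finset (Finset (Sym2 V))) : Finset (Sym2 (V ⊕ Finset (Sym2 V))) :=
  (Bs.sigma fun b => Finset.univ.filter fun v : V => ∃ e ∈ b, v ∈ e).image
    fun q => s(Sum.inl q.2, Sum.inr q.1)

lemma mem_blockIncidences {Bs : Finset (Finset (Sym2 V))} {q : Sym2 (V ⊕ Finset (Sym2 V))} :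
    q ∈ blockIncidences Bs ↔
      ∃ v, ∃ b ∈ Bs, (∃ e ∈ b, v ∈ e) ∧ q = s(Sum.inl v, Sum.inr b) := by
  simp only [blockIncidences, Finset.mem_image, Finset.mem_sigma, Finset.mem_filter,
    Finset.mem_univ, true_and]
  constructor
  · rintro ⟨⟨b, v⟩, ⟨hb, hv⟩, rfl⟩
    exact ⟨v, b, hb, hv, rfl⟩
  · rintro ⟨v, b, hb, hv, rfl⟩
    exact ⟨⟨b, v⟩, ⟨hb, hv⟩, rfl⟩

lemma card_blockIncidences (Bs : Finset (Finset (Sym2 V))) : (blockIncidences Bs).card =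
    ∑ b ∈ Bs, (Finset.univ.filter fun v : V => ∃ e ∈ b, v ∈ e).card := by
  rw [blockIncidences, Finset.card_image_of_injective, Finset.card_sigma]
  rintro ⟨b, v⟩ ⟨b', v'⟩ h
  simp only [Sym2.eq_iff, Sum.inl.injEq, Sum.inr.injEq, reduceCtorEq, and_self, or_false] at h
  obtain ⟨rfl, rfl⟩ := h
  rfl

lemma isBipartiteOn_blockIncidences (Bs : Finset (Finset (Sym2 V))) :
    IsBipartiteOn Sum.isLeft (Finset.univ.disjSum Bs) (blockIncidences Bs) := by
  intro x y h
  obtain ⟨v, b, hb, -, h⟩ := mem_blockIncidences.1 h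
  rcases Sym2.eq_iff.1 h with ⟨rfl, rfl⟩ | ⟨rfl, rfl⟩ <;> simp [hb]

lemma hasWeakDrawing_blockIncidences {ends : ℝ × ℝ → Sym2 (Sym2 V)} {X : Finset (ℝ × ℝ)}
    {Bs : Finset (Finset (Sym2 V))} (hBs : CrossingBlocks.IsBlockFamily ends X Bs)
    (hX : ∀ p, p ∈ X ↔ p ∈ D.crossings)
    (hends : ∀ p ∈ X, ∀ e, e ∈ ends p ↔ e ∈ G.edgeSet ∧ p ∈ D.trace e) :
    HasWeakDrawing (blockIncidences Bs) := by
  have hX' : ∀ p ∈ X, p ∉ range D.pos ∧ ∀ e ∈ ends p, e ∈ G.edgeSet ∧ p ∈ D.trace e :=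
    fun p hp => ⟨(D.mem_crossings_iff.1 ((hX p).1 hp)).1, fun e he => (hends p hp e).1 he⟩
  have hpt : ∀ b, ∃ c, b ∈ Bs → ∃ e ∈ b, c ∈ D.trace e ∧ c ∉ range D.pos := by
    intro b
    by_cases hb : b ∈ Bs
    · obtain ⟨e, he⟩ := (hBs.isBlock b hb).nonempty
      obtain ⟨p, hp, hpe⟩ := (hBs.isBlock b hb).exists_mem he
      exact ⟨p, fun _ => ⟨e, he, ((hX' p hp).2 e hpe).2, (hX' p hp).1⟩⟩
    · exact ⟨0, fun h => absurd h hb⟩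
  choose c hc using hpt
  let φ := Complex.equivRealProdCLM.symm
  let K : Sym2 (V ⊕ Finset (Sym2 V)) → Set ℂ := fun q =>
    {z | ∃ v b, q = s(Sum.inl v, Sum.inr b) ∧ z ∈ φ '' D.blockRegion b {v}ᶜ}
  have hK : ∀ v b, K s(Sum.inl v, Sum.inr b) = φ '' D.blockRegion b {v}ᶜ := by
    intro v b
    ext z
    constructor
    · rintro ⟨v', b', h, hz⟩
      simp only [Sym2.eq_iff, Sum.inl.injEq, Sum.inr.injEq, reduceCtorEq, and_self,
        or_false] at h
      obtain ⟨rfl, rfl⟩ := h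
      exact hz
    · exact fun hz => ⟨v, b, rfl, hz⟩
  refine ⟨K, Sum.elim (fun v => φ (D.pos v)) (fun b => φ (c b)), ?_, ?_⟩
  · intro q hq
    obtain ⟨v, b, hb, ⟨e, he, hve⟩, rfl⟩ := mem_blockIncidences.1 hq
    rw [hK]
    refine ⟨(D.isPathConnected_blockRegion (hBs.isBlock b hb) hX' _).image φ.continuous, ?_⟩
    intro x hx
    rcases Sym2.mem_iff.1 hx with rfl | rfl
    · refine mem_image_of_mem φ (D.mem_blockRegion.2 ⟨⟨e, he, ?_⟩, ?_⟩)
      · obtain ⟨p, hp, hpe⟩ := (hBs.isBlock b hb).exists_mem he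
        have heG := ((hX' p hp).2 e hpe).1
        rw [← Sym2.other_spec hve] at heG ⊢
        exact (D.isArc_trace heG).left_mem
      · rintro ⟨w, hw, hwv⟩
        exact hw (D.pos_inj hwv)
    · obtain ⟨f, hf, hcf, hcr⟩ := hc b hb
      exact mem_image_of_mem φ (D.mem_blockRegion.2
        ⟨⟨f, hf, hcf⟩, fun h => hcr (image_subset_range _ _ h)⟩)
  · intro q hq q' hq' hdis
    obtain ⟨v, b, hb, -, rfl⟩ := mem_blockIncidences.1 hq
    obtain ⟨v', b', hb', -, rfl⟩ := mem_blockIncidences.1 hq'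
    rw [hK, hK, disjoint_image_iff φ.injective, disjoint_left]
    have hvv : v ≠ v' := by
      rintro rfl
      exact hdis (Sum.inl v) (by simp) (by simp)
    have hbb : b ≠ b' := by
      rintro rfl
      exact hdis (Sum.inr b) (by simp) (by simp)
    intro p hp hp'
    obtain ⟨⟨e, he, hpe⟩, hpR⟩ := D.mem_blockRegion.1 hp
    obtain ⟨⟨f, hf, hpf⟩, hpR'⟩ := D.mem_blockRegion.1 hp'
    have hef : e ≠ f := by
      rintro rfl
      exact Finset.disjoint_left.1 (hBs.disjoint b hb b' hb' hbb) he hf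
    by_cases hpr : p ∈ range D.pos
    · obtain ⟨w, rfl⟩ := hpr
      have h1 : w = v := by
        by_contra h
        exact hpR ⟨w, h, rfl⟩
      have h2 : w = v' := by
        by_contra h
        exact hpR' ⟨w, h, rfl⟩
      exact hvv (h1.symm.trans h2)
    · have heG : e ∈ G.edgeSet := by
        obtain ⟨p, hp, hpe⟩ := (hBs.isBlock b hb).exists_mem he
        exact ((hX' p hp).2 e hpe).1
      have hfG : f ∈ G.edgeSet := by
        obtain ⟨p, hp, hpe⟩ := (hBs.isBlock b' hb').exists_mem hf
        exact ((hX' p hp).2 f hpe).1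
      have hpX : p ∈ X := (hX p).2 (D.mem_crossings_iff.2 ⟨hpr, e, heG, f, hfG, hef, hpe, hpf⟩)
      exact hBs.not_joined b hb b' hb' hbb e he f hf p hpX
        ((Sym2.mem_and_mem_iff hef).1
          ⟨(hends p hpX e).2 ⟨heG, hpe⟩, (hends p hpX f).2 ⟨hfG, hpf⟩⟩)

end Blocks

/-- A 2-plane drawing with the fewest crossings has few crossings. -/
lemma crossingCount_le_of_minimal {V : Type*} [Fintype V] {G : SimpleGraph V}
    (D : PlaneDrawing G) (hD : D.IsKPlane 2) (hn : 2 ≤ Fintype.card V)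
    (hmin : ∀ D' : PlaneDrawing G, D'.IsKPlane 2 → D.crossingCount ≤ D'.crossingCount) :
    3 * D.crossingCount + 20 ≤ 10 * Fintype.card V := by
  classical
  have : Nonempty V := Fintype.card_pos_iff.1 (by omega)
  obtain ⟨ends, hends⟩ := D.exists_crossing_ends
  set X := D.finite_crossings.toFinset with hXdef
  have hX : ∀ p, p ∈ X ↔ p ∈ D.crossings := fun p => D.finite_crossings.mem_toFinset
  have hcount : D.crossingCount = X.card := ncard_eq_toFinset_card _ D.finite_crossings
  have hends' : ∀ p ∈ X, ∀ e, e ∈ ends p ↔ e ∈ G.edgeSet ∧ p ∈ D.trace e := by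
    intro p hp g
    obtain ⟨e, he, f, hf, hne, hpe, hpte, hptf⟩ := hends p ((hX p).1 hp)
    rw [hpe, Sym2.mem_iff]
    constructor
    · rintro (rfl | rfl)
      · exact ⟨he, hpte⟩
      · exact ⟨hf, hptf⟩
    · rintro ⟨hg, hpg⟩
      by_contra! h
      exact (D.mem_crossings_iff.1 ((hX p).1 hp)).1
        (D.mem_range_pos_of_mem_trace₃ he hf hg hne h.1.symm h.2.symm hpte hptf hpg)
  have hdiag : ∀ p ∈ X, ¬ (ends p).IsDiag := by
    intro p hp
    obtain ⟨e, -, f, -, hne, hpe, -⟩ := hends p ((hX p).1 hp)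
    rwa [hpe, Sym2.mk_isDiag_iff]
  have hdisj : ∀ p ∈ X, ∀ e f, ends p = s(e, f) → ∀ v ∈ e, v ∉ f := by
    intro p hp e f hpe v hve hvf
    have h1 := (hends' p hp e).1 (by simp [hpe])
    have h2 := (hends' p hp f).1 (by simp [hpe])
    have hef : e ≠ f := by
      have := hdiag p hp
      rwa [hpe, Sym2.mk_isDiag_iff] at this
    rw [← Sym2.other_spec hve] at h1 hef
    rw [← Sym2.other_spec hvf] at h2 hef
    obtain ⟨D', hD', hlt⟩ := D.exists_fewer_crossings hD h1.1 h2.1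
      (fun h => hef (congrArg (fun y => s(v, y)) h))
      ⟨p, ⟨h1.2, h2.2⟩, fun h => (D.mem_crossings_iff.1 ((hX p).1 hp)).1 ⟨v, h.symm⟩⟩
    exact absurd (hmin D' hD') hlt.not_ge
  have hdeg : ∀ e, (X.filter (fun p => e ∈ ends p)).card ≤ 2 := by
    intro e
    by_cases he : e ∈ G.edgeSet
    · refine le_trans ?_ (D.isKPlane_iff.1 hD e he)
      rw [← ncard_coe_finset]
      refine ncard_le_ncard (fun p hp => ?_) (D.finite_crossings.inter_of_left _)
      obtain ⟨hp, hpe⟩ := Finset.mem_filter.1 hp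
      exact ⟨(hX p).1 hp, ((hends' p hp e).1 hpe).2⟩
    · rw [Finset.filter_false_of_mem fun p hp h => he ((hends' p hp e).1 h).1]
      simp
  obtain ⟨Bs, hBs, hle, -⟩ := CrossingBlocks.hasLargeFamily ends X hdiag hdeg
  rw [hcount]
  rcases Bs.eq_empty_or_nonempty with rfl | hne
  · simp only [Finset.sum_empty] at hle
    omega
  have hBpos : 1 ≤ Bs.card := hne.card_pos
  have hScard : (Finset.univ.disjSum Bs : Finset (V ⊕ Finset (Sym2 V))).card =
      Fintype.card V + Bs.card := by simp
  have hmain := (isBipartiteOn_blockIncidences Bs).card_add_four_le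
    (D.hasWeakDrawing_blockIncidences hBs hX hends') (by omega)
  rw [card_blockIncidences, hScard] at hmain
  have hsum : ∑ b ∈ Bs, (b.card + 2) ≤
      ∑ b ∈ Bs, (Finset.univ.filter fun v : V => ∃ e ∈ b, v ∈ e).card :=
    Finset.sum_le_sum fun b hb => card_add_two_le_of_isBlock (hBs.isBlock b hb)
      (fun p hp e he => G.not_isDiag_of_mem_edgeSet ((hends' p hp e).1 he).1) hdisj
  rw [Finset.sum_add_distrib, Finset.sum_const, smul_eq_mul] at hsum
  omega

end PlaneDrawing

end DrawingArgument

theorem stmt_2 {V : Type} [Fintype V] (G : SimpleGraph V)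
    (hG : KPlanar G 2) (hn : 2 ≤ Fintype.card V) :
    (∃ D : PlaneDrawing G,
        (D.crossingCount : ℝ) ≤ (10 * Fintype.card V - 20) / 3) ∧
      (crossingNumber G : ℝ) ≤ (10 * Fintype.card V - 20) / 3 := by
  obtain ⟨D, hD, hmin⟩ : ∃ D : PlaneDrawing G, D.IsKPlane 2 ∧
      ∀ D' : PlaneDrawing G, D'.IsKPlane 2 → D.crossingCount ≤ D'.crossingCount := by
    obtain ⟨D, hD, h⟩ := WellFounded.has_min (measure PlaneDrawing.crossingCount).wf
      {D : PlaneDrawing G | D.IsKPlane 2} hG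
    exact ⟨D, hD, fun D' hD' => not_lt.1 (h D' hD')⟩
  have key : (3 * D.crossingCount + 20 : ℝ) ≤ 10 * Fintype.card V := by
    exact_mod_cast D.crossingCount_le_of_minimal hD hn hmin
  have hle : (crossingNumber G : ℝ) ≤ D.crossingCount := by
    have h : crossingNumber G ≤ D.crossingCount := Nat.sInf_le ⟨D, rfl⟩
    exact_mod_cast h
  exact ⟨⟨D, by linarith⟩, by linarith⟩
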